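/- Assume α > 2 − 2/k, let a > 0, and fix δ ∈ (0, 1/2). Then, as n → ∞, C(n−(k−2), k) · ∫_{[1, n^{1/2+δ}]^k} f_n(x_1,…,x_k) dF(x_1)⋯dF(x_k) + (1/2)(n−(k−2))^2 · ∫_{[1, n^{1/2+δ}]^2} f_n(x_1, x_2, c_a(n), …, c_a(n)) dF(x_1) dF(x_2) = (1+a) · m_n^{(k)} · (1+o(1)); that is, the first (restricted) term is asymptotically m_n^{(k)} and the second term is asymptotically a · m_n^{(k)}. -/

import Mathlib

open MeasureTheory Filter Set

noncomputable section

/-- `f_n(h_1,…,h_k) = ∏_{1≤i<j≤k} min(h_i h_j/(μ n), 1)`. -/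
def fDef (μ : ℝ) (n k : ℕ) (x : Fin k → ℝ) : ℝ :=
  ∏ p ∈ Finset.univ.filter (fun p : Fin k × Fin k => p.1 < p.2),
    min (x p.1 * x p.2 / (μ * n)) 1

/-- Expected `k`-clique count `m_n^{(k)}`. -/
def mExp (ν : Measure ℝ) (μ : ℝ) (k n : ℕ) : ℝ :=
  (n.choose k : ℝ) *
    ∫ x in Set.univ.pi (fun _ : Fin k => Set.Ici (1 : ℝ)),
      fDef μ n k x ∂(Measure.pi fun _ : Fin k => ν)

/-- The weight vector `(x, y, c, …, c)`. -/
def hubVec (k : ℕ) (x y c : ℝ) : Fin k → ℝ :=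
  fun i => if i.val = 0 then x else if i.val = 1 then y else c

/-- `∫∫ f_n(x, y, c, …, c) dF(x) dF(y)`. -/
def twoInt (ν : Measure ℝ) (μ : ℝ) (k n : ℕ) (c : ℝ) : ℝ :=
  ∫ x in Set.Ici (1 : ℝ), ∫ y in Set.Ici (1 : ℝ),
    fDef μ n k (hubVec k x y c) ∂ν ∂ν

/-- `c_a(n)`, the smallest hub size creating an expected excess of `a m_n^{(k)}` cliques. -/
def cA (ν : Measure ℝ) (μ : ℝ) (k : ℕ) (a : ℝ) (n : ℕ) : ℝ :=
  sInf {c : ℝ | 0 < c ∧ a * mExp ν μ k n < (n.choose 2 : ℝ) * twoInt ν μ k n c}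


/-- Two-regime power function. -/
def phi (p q u : ℝ) : ℝ := if u ≤ 1 then u ^ p else u ^ q

lemma phi_nonneg (p q : ℝ) {u : ℝ} (hu : 0 < u) : 0 ≤ phi p q u := by
  unfold phi; split_ifs <;> positivity

lemma min_le_rpow' {t r : ℝ} (ht : 0 < t) (h0 : 0 ≤ r) (h1 : r ≤ 1) : min t 1 ≤ t ^ r := by
  rcases le_total t 1 with h | h
  · rw [min_eq_left h]
    calc t = t ^ (1 : ℝ) := (Real.rpow_one t).symm
      _ ≤ t ^ r := Real.rpow_le_rpow_of_exponent_ge ht h h1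
  · rw [min_eq_right h]
    exact Real.one_le_rpow h h0

lemma min01 {t : ℝ} (ht : 0 < t) : 0 ≤ min t 1 := le_min ht.le zero_le_one

lemma tri_one {p q u v w : ℝ} (hu : 1 < u) (hv : 0 < v) (hv1 : v ≤ 1) (hw : 0 < w) (hw1 : w ≤ 1)
    (hp1 : 1 ≤ p) (hp2 : p ≤ 2) (hq1 : 2 * p - 2 ≤ q) :
    min (u * v) 1 * min (u * w) 1 * min (v * w) 1 ≤ phi p q u * phi p q v * phi p q w := by
  have hu0 : 0 < u := by linarith
  have h1 := min_le_rpow' (mul_pos hu0 hv) (r := p - 1) (by linarith) (by linarith)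
  have h2 := min_le_rpow' (mul_pos hu0 hw) (r := p - 1) (by linarith) (by linarith)
  have h3 : min (v * w) 1 ≤ v * w := min_le_left _ _
  have e : phi p q u * phi p q v * phi p q w = u ^ q * v ^ p * w ^ p := by
    simp [phi, hv1, hw1, not_le.2 hu]
  rw [e]
  calc min (u * v) 1 * min (u * w) 1 * min (v * w) 1
      ≤ (u * v) ^ (p - 1) * (u * w) ^ (p - 1) * (v * w) := by
        apply mul_le_mul (mul_le_mul h1 h2 (min01 (by positivity)) (by positivity)) h3
          (min01 (by positivity)) (by positivity)
    _ = u ^ (2 * p - 2) * v ^ p * w ^ p := by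
        rw [Real.mul_rpow hu0.le hv.le, Real.mul_rpow hu0.le hw.le,
          show 2 * p - 2 = (p - 1) + (p - 1) by ring, Real.rpow_add hu0,
          Real.rpow_sub_one hv.ne', Real.rpow_sub_one hw.ne']
        field_simp
    _ ≤ u ^ q * v ^ p * w ^ p := by
        gcongr
        exact hu.le

lemma tri_two {p q u v w : ℝ} (hu : 1 < u) (hv : 1 < v) (hw : 0 < w) (hw1 : w ≤ 1)
    (hp1 : 1 ≤ p) (hp2 : p ≤ 2) (hq2 : p / 2 ≤ q) :
    min (u * v) 1 * min (u * w) 1 * min (v * w) 1 ≤ phi p q u * phi p q v * phi p q w := by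
  have hu0 : 0 < u := by linarith
  have hv0 : 0 < v := by linarith
  have h1 : min (u * v) 1 ≤ 1 := min_le_right _ _
  have h2 := min_le_rpow' (mul_pos hu0 hw) (r := p / 2) (by linarith) (by linarith)
  have h3 := min_le_rpow' (mul_pos hv0 hw) (r := p / 2) (by linarith) (by linarith)
  have e : phi p q u * phi p q v * phi p q w = u ^ q * v ^ q * w ^ p := by
    simp [phi, hw1, not_le.2 hu, not_le.2 hv]
  rw [e]
  calc min (u * v) 1 * min (u * w) 1 * min (v * w) 1
      ≤ 1 * (u * w) ^ (p / 2) * (v * w) ^ (p / 2) := by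
        apply mul_le_mul (mul_le_mul h1 h2 (min01 (by positivity)) (by positivity)) h3
          (min01 (by positivity)) (by positivity)
    _ = u ^ (p / 2) * v ^ (p / 2) * w ^ p := by
        rw [Real.mul_rpow hu0.le hw.le, Real.mul_rpow hv0.le hw.le]
        have : w ^ p = w ^ (p / 2) * w ^ (p / 2) := by
          rw [← Real.rpow_add hw]; congr 1; ring
        rw [this]; ring
    _ ≤ u ^ q * v ^ q * w ^ p := by
        gcongr
        · exact hu.le
        · exact hv.le

lemma tri_bound {p q u v w : ℝ} (hu : 0 < u) (hv : 0 < v) (hw : 0 < w)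
    (hp1 : 1 ≤ p) (hp2 : p ≤ 2) (hq1 : 2 * p - 2 ≤ q) (hq2 : p / 2 ≤ q) :
    min (u * v) 1 * min (u * w) 1 * min (v * w) 1 ≤ phi p q u * phi p q v * phi p q w := by
  rcases le_or_gt u 1 with hu1 | hu1 <;> rcases le_or_gt v 1 with hv1 | hv1 <;>
    rcases le_or_gt w 1 with hw1 | hw1
  · have e : phi p q u * phi p q v * phi p q w = u ^ p * v ^ p * w ^ p := by
      simp [phi, hu1, hw1, hv1]
    rw [e]
    have k : ∀ t : ℝ, 0 < t → t ≤ 1 → t ^ 2 ≤ t ^ p := fun t h h' => by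
      rw [← Real.rpow_natCast]
      exact Real.rpow_le_rpow_of_exponent_ge h h' (by push_cast; linarith)
    calc
      min (u * v) 1 * min (u * w) 1 * min (v * w) 1 ≤ (u * v) * (u * w) * (v * w) := by
        apply mul_le_mul (mul_le_mul (min_le_left _ _) (min_le_left _ _) (min01 (by positivity))
          (by positivity)) (min_le_left _ _) (min01 (by positivity)) (by positivity)
      _ = u ^ 2 * v ^ 2 * w ^ 2 := by ring
      _ ≤ _ := by
        gcongr
        · exact k u hu hu1
        · exact k v hv hv1
        · exact k w hw hw1
  · have := tri_one (p := p) (q := q) hw1 hu hu1 hv hv1 hp1 hp2 hq1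
    rw [mul_comm w u, mul_comm w v] at this
    linarith
  · have := tri_one (p := p) (q := q) hv1 hu hu1 hw hw1 hp1 hp2 hq1
    rw [mul_comm v u] at this
    linarith
  · have := tri_two (p := p) (q := q) hv1 hw1 hu hu1 hp1 hp2 hq2
    rw [mul_comm v u, mul_comm w u] at this
    linarith
  · exact tri_one hu1 hv hv1 hw hw1 hp1 hp2 hq1
  · have := tri_two (p := p) (q := q) hu1 hw1 hv hv1 hp1 hp2 hq2
    rw [mul_comm w v] at this
    linarith
  · exact tri_two hu1 hv1 hw hw1 hp1 hp2 hq2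
  · have e : phi p q u * phi p q v * phi p q w = u ^ q * v ^ q * w ^ q := by
      simp [phi, not_le.2 hu1, not_le.2 hw1, not_le.2 hv1]
    rw [e]
    have hq : 0 ≤ q := by linarith
    have a1 := Real.one_le_rpow hu1.le hq
    have a2 := Real.one_le_rpow hv1.le hq
    have a3 := Real.one_le_rpow hw1.le hq
    calc
      min (u * v) 1 * min (u * w) 1 * min (v * w) 1 ≤ 1 * 1 * 1 := by
        apply mul_le_mul (mul_le_mul (min_le_right _ _) (min_le_right _ _) (min01 (by positivity))
          (by positivity)) (min_le_right _ _) (min01 (by positivity)) (by positivity)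
      _ ≤ _ := by gcongr

/-- Product over ordered pairs. -/
def gPr {ι : Type*} [DecidableEq ι] (u : ι → ℝ) (S : Finset ι) : ℝ :=
  ∏ p ∈ S.offDiag, min (u p.1 * u p.2) 1

lemma gPr_insert {ι : Type*} [DecidableEq ι] (u : ι → ℝ) (S : Finset ι) (v : ι) (hv : v ∉ S) :
    gPr u (insert v S) = gPr u S * (∏ j ∈ S, min (u v * u j) 1) ^ 2 := by
  unfold gPr
  have h1 : (insert v S).offDiag = S.offDiag ∪ (({v} : Finset ι) ×ˢ S ∪ S ×ˢ ({v} : Finset ι)) := by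
    ext ⟨x, y⟩
    simp only [Finset.mem_offDiag, Finset.mem_insert, Finset.mem_union, Finset.mem_product,
      Finset.mem_singleton]
    grind
  rw [h1, Finset.prod_union, Finset.prod_union, Finset.prod_product, Finset.prod_product_right]
  · simp only [Finset.prod_singleton]
    rw [sq]
    congr 2
    exact Finset.prod_congr rfl fun j _ => by rw [mul_comm]
  · rw [Finset.disjoint_left]
    rintro ⟨x, y⟩
    simp only [Finset.mem_product, Finset.mem_singleton]
    grind
  · rw [Finset.disjoint_left]
    rintro ⟨x, y⟩
    simp only [Finset.mem_product, Finset.mem_singleton, Finset.mem_offDiag, Finset.mem_union]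
    grind

lemma gPr_bound {ι : Type*} [DecidableEq ι] (u : ι → ℝ) (hu : ∀ i, 0 < u i) {p q : ℝ}
    (hp1 : 1 ≤ p) (hp2 : p ≤ 2) (hq1 : 2 * p - 2 ≤ q) (hq2 : p / 2 ≤ q) (m : ℕ) :
    ∀ S : Finset ι, S.card = m + 3 → gPr u S ≤ (∏ i ∈ S, phi p q (u i)) ^ 2 := by
  have hg0 : ∀ S : Finset ι, 0 ≤ gPr u S := fun S =>
    Finset.prod_nonneg fun i _ => min01 (mul_pos (hu _) (hu _))
  have hf0 : ∀ S : Finset ι, 0 ≤ ∏ i ∈ S, phi p q (u i) := fun S =>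
    Finset.prod_nonneg fun i _ => phi_nonneg _ _ (hu i)
  have he0 : ∀ (v : ι) (S : Finset ι), 0 ≤ ∏ j ∈ S, min (u v * u j) 1 := fun v S =>
    Finset.prod_nonneg fun i _ => min01 (mul_pos (hu _) (hu _))
  induction m with
  | zero =>
    intro S hS
    obtain ⟨a, b, c, hab, hac, hbc, rfl⟩ := Finset.card_eq_three.1 (by simpa using hS)
    have hc : c ∉ (∅ : Finset ι) := by simp
    rw [gPr_insert u _ a (by simp [hab, hac]), gPr_insert u _ b (by simp [hbc])]
    have : gPr u {c} = 1 := by simp [gPr]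
    rw [this, Finset.prod_pair hbc, Finset.prod_insert (by simp [hab, hac]),
      Finset.prod_pair hbc, Finset.prod_singleton]
    have h := tri_bound (hu a) (hu b) (hu c) hp1 hp2 hq1 hq2
    rw [one_mul, ← mul_pow]
    have n1 := min01 (mul_pos (hu a) (hu b))
    have n2 := min01 (mul_pos (hu a) (hu c))
    have n3 := min01 (mul_pos (hu b) (hu c))
    apply pow_le_pow_left₀ (by positivity)
    linarith
  | succ m ih =>
    intro S hS
    by_cases hbig : ∃ v ∈ S, 1 < u v
    · obtain ⟨v, hvS, hv⟩ := hbig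
      have hcard : (S.erase v).card = m + 3 := by rw [Finset.card_erase_of_mem hvS]; omega
      have h1 := ih _ hcard
      rw [← Finset.insert_erase hvS, gPr_insert u _ v (by simp), Finset.prod_insert (by simp)]
      have h2 : ∏ j ∈ S.erase v, min (u v * u j) 1 ≤ 1 :=
        Finset.prod_le_one (fun j _ => min01 (mul_pos (hu _) (hu _))) fun j _ => min_le_right _ _
      have h3 : 1 ≤ phi p q (u v) := by
        simp only [phi, not_le.2 hv, if_false]
        exact Real.one_le_rpow hv.le (by linarith)
      calc _ ≤ (∏ i ∈ S.erase v, phi p q (u i)) ^ 2 * 1 ^ 2 := by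
            gcongr
            exact he0 _ _
        _ = (1 * ∏ i ∈ S.erase v, phi p q (u i)) ^ 2 := by ring
        _ ≤ _ := by
            have := hf0 (S.erase v)
            gcongr
    · push Not at hbig
      obtain ⟨v, hvS⟩ : S.Nonempty := Finset.card_pos.1 (by omega)
      have hcard : (S.erase v).card = m + 3 := by rw [Finset.card_erase_of_mem hvS]; omega
      have h1 := ih _ hcard
      have hv := hbig v hvS
      rw [← Finset.insert_erase hvS, gPr_insert u _ v (by simp), Finset.prod_insert (by simp)]
      have h2 : ∏ j ∈ S.erase v, min (u v * u j) 1 ≤ phi p q (u v) := by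
        calc ∏ j ∈ S.erase v, min (u v * u j) 1 ≤ ∏ j ∈ S.erase v, u v := by
              apply Finset.prod_le_prod
              · intro j _; exact min01 (mul_pos (hu _) (hu _))
              · intro j hj
                refine (min_le_left _ _).trans ?_
                exact mul_le_of_le_one_right (hu v).le (hbig j (Finset.mem_of_mem_erase hj))
          _ = (u v) ^ ((m + 3 : ℕ) : ℝ) := by
              rw [Finset.prod_const, hcard, Real.rpow_natCast]
          _ ≤ _ := by
              simp only [phi, hv, if_true]
              apply Real.rpow_le_rpow_of_exponent_ge (hu v) hv
              push_cast
              have : (0 : ℝ) ≤ m := by positivity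
              linarith
      calc _ ≤ (∏ i ∈ S.erase v, phi p q (u i)) ^ 2 * (phi p q (u v)) ^ 2 := by
            gcongr
            exact he0 _ _
        _ = _ := by ring

lemma fsq {k : ℕ} (u : Fin k → ℝ) :
    (∏ p ∈ Finset.univ.filter (fun p : Fin k × Fin k => p.1 < p.2), min (u p.1 * u p.2) 1) ^ 2
      = gPr u Finset.univ := by
  unfold gPr
  have h1 : (Finset.univ : Finset (Fin k)).offDiag =
      Finset.univ.filter (fun p : Fin k × Fin k => p.1 < p.2) ∪
      Finset.univ.filter (fun p : Fin k × Fin k => p.2 < p.1) := by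
    ext ⟨x, y⟩
    simp [Finset.mem_offDiag]
  rw [h1, Finset.prod_union, sq]
  · congr 1
    apply Finset.prod_bij' (fun p _ => p.swap) (fun p _ => p.swap) <;> simp [mul_comm]
  · rw [Finset.disjoint_left]
    rintro ⟨x, y⟩
    simp only [Finset.mem_filter, Finset.mem_univ, true_and]
    intro h
    exact not_lt.2 h.le

lemma fDef_nonneg {μ : ℝ} {n k : ℕ} (hμ : 0 < μ) {x : Fin k → ℝ} (hx : ∀ i, 0 ≤ x i) :
    0 ≤ fDef μ n k x :=
  Finset.prod_nonneg fun p _ => le_min (div_nonneg (mul_nonneg (hx _) (hx _)) (by positivity))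
    zero_le_one

lemma fDef_le_one {μ : ℝ} {n k : ℕ} (hμ : 0 < μ) {x : Fin k → ℝ} (hx : ∀ i, 0 ≤ x i) :
    fDef μ n k x ≤ 1 :=
  Finset.prod_le_one (fun p _ => le_min (div_nonneg (mul_nonneg (hx _) (hx _)) (by positivity))
    zero_le_one) fun p _ => min_le_right _ _

lemma fDef_bound {μ s : ℝ} {n k : ℕ} (hk : 3 ≤ k) (hs : 0 < s) (hsq : s ^ 2 = μ * n)
    {x : Fin k → ℝ} (hx : ∀ i, 0 < x i) {p q : ℝ}
    (hp1 : 1 ≤ p) (hp2 : p ≤ 2) (hq1 : 2 * p - 2 ≤ q) (hq2 : p / 2 ≤ q) :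
    fDef μ n k x ≤ ∏ i, phi p q (x i / s) := by
  have hu : ∀ i, 0 < x i / s := fun i => div_pos (hx i) hs
  have h := gPr_bound (fun i => x i / s) hu hp1 hp2 hq1 hq2 (k - 3)
    (Finset.univ : Finset (Fin k)) (by simp; omega)
  rw [← fsq] at h
  have e : fDef μ n k x = ∏ p ∈ Finset.univ.filter (fun p : Fin k × Fin k => p.1 < p.2),
      min (x p.1 / s * (x p.2 / s)) 1 := by
    unfold fDef
    refine Finset.prod_congr rfl fun p _ => ?_
    congr 1
    rw [← hsq]
    field_simp
  rw [e]
  exact (pow_le_pow_iff_left₀ (Finset.prod_nonneg fun p _ => min01 (mul_pos (hu _) (hu _))) (Finset.prod_nonneg fun i _ => phi_nonneg _ _ (hu i)) two_ne_zero).1 h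
lemma nu_le {ν : Measure ℝ} {g : ℝ → ℝ}
    (hdens : ν = MeasureTheory.volume.withDensity (fun x => ENNReal.ofReal (g x)))
    {w : ℝ → ℝ} (hw : Measurable w) {B : Set ℝ} (hB : MeasurableSet B)
    (hg : ∀ x ∈ B, g x ≤ w x) {h : ℝ → ENNReal} (hh : Measurable h) :
    ∫⁻ x in B, h x ∂ν ≤ ∫⁻ x in B, ENNReal.ofReal (w x) * h x := by
  rw [hdens, restrict_withDensity hB]
  calc _ ≤ ∫⁻ x, h x ∂((volume.restrict B).withDensity (fun x => ENNReal.ofReal (w x))) := by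
        apply lintegral_mono' _ le_rfl
        apply withDensity_mono
        filter_upwards [ae_restrict_mem hB] with x hx
        exact ENNReal.ofReal_le_ofReal (hg x hx)
    _ = _ := by
        rw [lintegral_withDensity_eq_lintegral_mul _ hw.ennreal_ofReal hh]
        rfl

lemma nu_transfer {ν : Measure ℝ} {g : ℝ → ℝ}
    (hdens : ν = MeasureTheory.volume.withDensity (fun x => ENNReal.ofReal (g x)))
    {w : ℝ → ℝ} (hw : Measurable w) {B : Set ℝ} (hB : MeasurableSet B)
    (hg : ∀ x ∈ B, g x ≤ w x) (hw0 : ∀ x ∈ B, 0 ≤ w x) {h : ℝ → ℝ} (hh : Measurable h)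
    (hh0 : ∀ x ∈ B, 0 ≤ h x)
    (hi : IntegrableOn (fun x => w x * h x) B volume) :
    IntegrableOn h B ν ∧ ∫ x in B, h x ∂ν ≤ ∫ x in B, w x * h x := by
  have h1 := nu_le hdens hw hB hg (hh.ennreal_ofReal)
  have h2 : ∫⁻ x in B, ENNReal.ofReal (w x) * ENNReal.ofReal (h x)
      = ∫⁻ x in B, ENNReal.ofReal (w x * h x) := by
    apply setLIntegral_congr_fun hB
    intro x hx
    exact (ENNReal.ofReal_mul (hw0 x hx)).symm
  rw [h2] at h1
  have h3 : ∫⁻ x in B, ENNReal.ofReal (w x * h x) < ⊤ := hi.lintegral_lt_top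
  have n1 : 0 ≤ᵐ[ν.restrict B] h := by
    filter_upwards [ae_restrict_mem hB] with x hx using hh0 x hx
  have n2 : 0 ≤ᵐ[volume.restrict B] fun x => w x * h x := by
    filter_upwards [ae_restrict_mem hB] with x hx using mul_nonneg (hw0 x hx) (hh0 x hx)
  have I : IntegrableOn h B ν := by
    refine ⟨hh.aestronglyMeasurable, ?_⟩
    rw [hasFiniteIntegral_iff_ofReal n1]
    exact h1.trans_lt h3
  refine ⟨I, ?_⟩
  rw [integral_eq_lintegral_of_nonneg_ae n1 hh.aestronglyMeasurable,
    integral_eq_lintegral_of_nonneg_ae n2 (hw.mul hh).aestronglyMeasurable]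
  exact ENNReal.toReal_mono h3.ne h1

lemma g_bound {α : ℝ} {g : ℝ → ℝ}
    (hgtail : Tendsto (fun x : ℝ => g x * x ^ (α + 1)) atTop (nhds α)) :
    ∃ x0 : ℝ, 1 ≤ x0 ∧ ∀ x, x0 < x → g x ≤ (α + 1) * x ^ (-α - 1) := by
  have h := (hgtail.eventually_lt_const (show α < α + 1 by linarith)).and (eventually_gt_atTop 0)
  obtain ⟨x0, h0⟩ := eventually_atTop.1 h
  refine ⟨max x0 1, le_max_right _ _, fun x hx => ?_⟩
  obtain ⟨h1, h2⟩ := h0 x ((le_max_left _ _).trans hx.le)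
  have h3 : 0 < x ^ (α + 1) := Real.rpow_pos_of_pos h2 _
  rw [show -α - 1 = -(α + 1) by ring, Real.rpow_neg h2.le, ← div_eq_mul_inv, le_div_iff₀ h3]
  exact h1.le

lemma tail_moment {α : ℝ} {ν : Measure ℝ} {g : ℝ → ℝ} (hα : 1 < α)
    (hdens : ν = MeasureTheory.volume.withDensity (fun x => ENNReal.ofReal (g x)))
    {x0 : ℝ} (hx0 : 1 ≤ x0) (hg : ∀ x, x0 < x → g x ≤ (α + 1) * x ^ (-α - 1))
    {r : ℝ} (hr : r < α) {A : ℝ} (hA : x0 ≤ A) :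
    IntegrableOn (fun x : ℝ => x ^ r) (Ioi A) ν ∧
      ∫ x in Ioi A, x ^ r ∂ν ≤ (α + 1) / (α - r) * A ^ (r - α) := by
  have hA0 : 0 < A := by linarith
  have e : ∀ x ∈ Ioi A, (α + 1) * x ^ (r - α - 1) = (α + 1) * x ^ (-α - 1) * x ^ r := by
    intro x hx
    have : 0 < x := hA0.trans hx
    rw [mul_assoc, ← Real.rpow_add this]; congr 2; ring
  have hi : IntegrableOn (fun x : ℝ => (α + 1) * x ^ (r - α - 1)) (Ioi A) volume :=
    (integrableOn_Ioi_rpow_of_lt (by linarith) hA0).const_mul _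
  have key := nu_transfer (B := Ioi A) (w := fun x => (α + 1) * x ^ (-α - 1)) (h := fun x => x ^ r)
    hdens (by fun_prop) measurableSet_Ioi
    (fun x hx => hg x (lt_of_le_of_lt hA hx))
    (fun x hx => by
      have : 0 < x := hA0.trans hx
      positivity) (by fun_prop)
    (fun x hx => by
      have : 0 < x := hA0.trans hx
      positivity) (hi.congr_fun e measurableSet_Ioi)
  refine ⟨key.1, key.2.trans ?_⟩
  rw [← setIntegral_congr_fun measurableSet_Ioi e, integral_const_mul,
    integral_Ioi_rpow_of_lt (by linarith) hA0]
  have : α - r ≠ 0 := by linarith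
  rw [show r - α - 1 + 1 = -(α - r) by ring, show r - α = -(α - r) by ring]
  apply le_of_eq
  field_simp

lemma low_moment {α : ℝ} {ν : Measure ℝ} [IsProbabilityMeasure ν] {g : ℝ → ℝ} (hα : 1 < α)
    (hdens : ν = MeasureTheory.volume.withDensity (fun x => ENNReal.ofReal (g x)))
    {x0 : ℝ} (hx0 : 1 ≤ x0) (hg : ∀ x, x0 < x → g x ≤ (α + 1) * x ^ (-α - 1))
    {p : ℝ} (hp : α < p) {s : ℝ} (hs : x0 ≤ s) :
    IntegrableOn (fun x : ℝ => x ^ p) (Icc 1 s) ν ∧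
      ∫ x in Icc 1 s, x ^ p ∂ν ≤ (x0 ^ p + (α + 1) / (p - α)) * s ^ (p - α) := by
  have hx00 : 0 < x0 := by linarith
  have hs0 : 0 < s := by linarith
  have e : ∀ x ∈ Ioc x0 s, (α + 1) * x ^ (p - α - 1) = (α + 1) * x ^ (-α - 1) * x ^ p := by
    intro x hx
    have : 0 < x := hx00.trans hx.1
    rw [mul_assoc, ← Real.rpow_add this]; congr 2; ring
  have hi : IntegrableOn (fun x : ℝ => (α + 1) * x ^ (p - α - 1)) (Ioc x0 s) volume := by
    apply Integrable.const_mul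
    have := intervalIntegral.intervalIntegrable_rpow' (a := x0) (b := s) (r := p - α - 1)
      (by linarith)
    exact (intervalIntegrable_iff_integrableOn_Ioc_of_le hs).1 this
  have key := nu_transfer (B := Ioc x0 s) (w := fun x => (α + 1) * x ^ (-α - 1))
    (h := fun x => x ^ p)
    hdens (by fun_prop) measurableSet_Ioc
    (fun x hx => hg x hx.1)
    (fun x hx => by
      have : 0 < x := hx00.trans hx.1
      positivity) (by fun_prop)
    (fun x hx => by
      have : 0 < x := hx00.trans hx.1
      positivity) (hi.congr_fun e measurableSet_Ioc)
  have low : IntegrableOn (fun x : ℝ => x ^ p) (Icc 1 x0) ν := by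
    apply ContinuousOn.integrableOn_compact isCompact_Icc
    apply ContinuousOn.rpow_const continuousOn_id
    intro x hx; left; exact (by linarith [hx.1] : (0 : ℝ) < x).ne'
  have lowb : ∫ x in Icc 1 x0, x ^ p ∂ν ≤ x0 ^ p := by
    calc _ ≤ ∫ x in Icc 1 x0, x0 ^ p ∂ν := by
          apply setIntegral_mono_on low (integrable_const _) measurableSet_Icc
          intro x hx
          exact Real.rpow_le_rpow (by linarith [hx.1]) hx.2 (by linarith)
      _ ≤ 1 * x0 ^ p := by
          rw [setIntegral_const, smul_eq_mul]
          gcongr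
          exact measureReal_le_one
      _ = _ := one_mul _
  have hU : Icc 1 s = Icc 1 x0 ∪ Ioc x0 s := (Icc_union_Ioc_eq_Icc hx0 hs).symm
  have hd : Disjoint (Icc 1 x0) (Ioc x0 s) := by
    rw [Set.disjoint_left]; intro x h1 h2; exact not_lt.2 h1.2 h2.1
  rw [hU]
  refine ⟨low.union key.1, ?_⟩
  rw [setIntegral_union hd measurableSet_Ioc low key.1]
  have h2 : ∫ x in Ioc x0 s, (α + 1) * x ^ (-α - 1) * x ^ p ≤ (α + 1) / (p - α) * s ^ (p - α) := by
    rw [← setIntegral_congr_fun measurableSet_Ioc e, integral_const_mul,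
      ← intervalIntegral.integral_of_le hs, integral_rpow (Or.inl (by linarith))]
    have h3 : 0 < p - α := by linarith
    rw [show p - α - 1 + 1 = p - α by ring, div_mul_eq_mul_div, mul_div_assoc]
    have : 0 ≤ x0 ^ (p - α) := by positivity
    gcongr
    linarith
  have h4 : 1 ≤ s ^ (p - α) := Real.one_le_rpow (by linarith) (by linarith)
  have h5 : 0 ≤ x0 ^ p := by positivity
  calc _ ≤ x0 ^ p * 1 + (α + 1) / (p - α) * s ^ (p - α) := by
        linarith [key.2]
    _ ≤ x0 ^ p * s ^ (p - α) + (α + 1) / (p - α) * s ^ (p - α) := by gcongr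
    _ = _ := by ring

/-- integral of `phi (x/s)` -/
lemma phi_moment {α : ℝ} {ν : Measure ℝ} [IsProbabilityMeasure ν] {g : ℝ → ℝ} (hα : 1 < α)
    (hdens : ν = MeasureTheory.volume.withDensity (fun x => ENNReal.ofReal (g x)))
    {x0 : ℝ} (hx0 : 1 ≤ x0) (hg : ∀ x, x0 < x → g x ≤ (α + 1) * x ^ (-α - 1))
    {p q : ℝ} (hp : α < p) (hq : q < α) :
    ∃ C : ℝ, 0 < C ∧ ∀ s, x0 ≤ s →
      IntegrableOn (fun x : ℝ => phi p q (x / s)) (Ici 1) ν ∧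
      ∫ x in Ici 1, phi p q (x / s) ∂ν ≤ C * s ^ (-α) ∧
      ∀ T, s ≤ T → ∫ x in Ioi T, phi p q (x / s) ∂ν ≤ C * s ^ (-q) * T ^ (q - α) := by
  refine ⟨(x0 ^ p + (α + 1) / (p - α)) + (α + 1) / (α - q), ?_, fun s hs => ?_⟩
  · have : 0 < p - α := by linarith
    have : 0 < α - q := by linarith
    have : 0 < x0 ^ p := by positivity
    positivity
  have hs0 : 0 < s := by linarith
  have L := low_moment hα hdens hx0 hg hp hs
  have e1 : ∀ x ∈ Icc 1 s, x ^ p * s ^ (-p) = phi p q (x / s) := by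
    intro x hx
    have h1 : x / s ≤ 1 := (div_le_one hs0).2 hx.2
    simp only [phi, h1, if_true]
    rw [Real.div_rpow (by linarith [hx.1]) hs0.le, Real.rpow_neg hs0.le]; rfl
  have e2 : ∀ x ∈ Ioi s, x ^ q * s ^ (-q) = phi p q (x / s) := by
    intro x hx
    have h1 : ¬ x / s ≤ 1 := not_le.2 ((one_lt_div hs0).2 hx)
    simp only [phi, h1, if_false]
    rw [Real.div_rpow (hs0.trans hx).le hs0.le, Real.rpow_neg hs0.le]; rfl
  have i1 : IntegrableOn (fun x : ℝ => phi p q (x / s)) (Icc 1 s) ν :=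
    IntegrableOn.congr_fun (L.1.mul_const _) e1 measurableSet_Icc
  have tl : ∀ T, s ≤ T → IntegrableOn (fun x : ℝ => phi p q (x / s)) (Ioi T) ν ∧
      ∫ x in Ioi T, phi p q (x / s) ∂ν ≤ (α + 1) / (α - q) * T ^ (q - α) * s ^ (-q) := by
    intro T hT
    have M := tail_moment hα hdens hx0 hg hq (hs.trans hT)
    have e3 : ∀ x ∈ Ioi T, x ^ q * s ^ (-q) = phi p q (x / s) := fun x hx =>
      e2 x (lt_of_le_of_lt hT hx)
    refine ⟨IntegrableOn.congr_fun (M.1.mul_const _) e3 measurableSet_Ioi, ?_⟩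
    rw [← setIntegral_congr_fun measurableSet_Ioi e3, integral_mul_const]
    have := M.2
    gcongr
  have hC1 : 0 ≤ x0 ^ p + (α + 1) / (p - α) := by
    have : 0 < p - α := by linarith
    positivity
  have hC2 : 0 ≤ (α + 1) / (α - q) := by
    have : 0 < α - q := by linarith
    positivity
  have hU : Ici 1 = Icc 1 s ∪ Ioi s := (Icc_union_Ioi_eq_Ici (by linarith)).symm
  have hd : Disjoint (Icc 1 s) (Ioi s) := by
    rw [Set.disjoint_left]; intro x h1 h2; exact not_lt.2 h1.2 h2
  refine ⟨by rw [hU]; exact i1.union (tl s le_rfl).1, ?_, ?_⟩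
  · rw [hU, setIntegral_union hd measurableSet_Ioi i1 (tl s le_rfl).1,
      ← setIntegral_congr_fun measurableSet_Icc e1, integral_mul_const, add_mul]
    apply add_le_add
    · calc _ ≤ (x0 ^ p + (α + 1) / (p - α)) * s ^ (p - α) * s ^ (-p) := by
            have := L.2
            gcongr
        _ = _ := by rw [mul_assoc, ← Real.rpow_add hs0]; congr 2; ring
    · calc _ ≤ (α + 1) / (α - q) * s ^ (q - α) * s ^ (-q) := (tl s le_rfl).2
        _ = _ := by rw [mul_assoc, ← Real.rpow_add hs0]; congr 2; ring
  · intro T hT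
    have hT0 : 0 < T := by linarith
    refine (tl T hT).2.trans ?_
    rw [mul_right_comm]
    gcongr
    linarith
lemma tail_lower {α : ℝ} {ν : Measure ℝ}
    (htail : Tendsto (fun x : ℝ => x ^ α * (ν (Set.Ioi x)).toReal) atTop (nhds 1)) :
    ∀ᶠ s : ℝ in atTop, 1 / 2 * s ^ (-α) ≤ (ν (Set.Ioi s)).toReal := by
  filter_upwards [htail.eventually_const_lt (show (1 / 2 : ℝ) < 1 by norm_num),
    eventually_gt_atTop 0] with s h1 h2
  have h3 : 0 < s ^ α := Real.rpow_pos_of_pos h2 _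
  rw [Real.rpow_neg h2.le, ← div_eq_mul_inv, div_le_iff₀ h3]
  linarith

lemma mid_lower {α : ℝ} {ν : Measure ℝ} [IsProbabilityMeasure ν] (hα : 1 < α)
    (hint : Integrable (fun x : ℝ => x) ν)
    (htail : Tendsto (fun x : ℝ => x ^ α * (ν (Set.Ioi x)).toReal) atTop (nhds 1)) :
    ∃ c : ℝ, 0 < c ∧ ∀ᶠ s : ℝ in atTop, c * s ^ (1 - α) ≤ ∫ x in Ioc (s / 2) s, x ∂ν := by
  have h2a : (1 : ℝ) < 2 ^ α := Real.one_lt_rpow (by norm_num) (by linarith)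
  have ht2 : Tendsto (fun s : ℝ => s / 2) atTop atTop :=
    tendsto_id.atTop_div_const (by norm_num)
  have hd := ((htail.comp ht2).const_mul (2 ^ α)).sub htail
  refine ⟨(2 ^ α - 1) / 4, by linarith, ?_⟩
  filter_upwards [hd.eventually_const_lt (show ((2 : ℝ) ^ α - 1) / 2 < 2 ^ α * 1 - 1 by linarith),
    eventually_gt_atTop 0] with s h1 h0
  simp only [Function.comp] at h1
  rw [Real.div_rpow h0.le (by norm_num)] at h1
  have h3 : 0 < s ^ α := Real.rpow_pos_of_pos h0 _
  have e1 : ν.real (Ioc (s / 2) s) = ν.real (Ioi (s / 2)) - ν.real (Ioi s) := by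
    rw [← measureReal_sdiff (Ioi_subset_Ioi (by linarith)) measurableSet_Ioi]
    congr 1
    ext x; simp
  have h4 : (2 ^ α - 1) / 2 < s ^ α * ν.real (Ioc (s / 2) s) := by
    rw [e1]
    simp only [Measure.real]
    have : (0 : ℝ) < 2 ^ α := by positivity
    field_simp at h1
    linarith
  calc (2 ^ α - 1) / 4 * s ^ (1 - α) = s / 2 * ((2 ^ α - 1) / 2 * (s ^ α)⁻¹) := by
        rw [Real.rpow_sub h0, Real.rpow_one]; field_simp; ring
    _ ≤ s / 2 * ν.real (Ioc (s / 2) s) := by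
        gcongr
        rw [← div_eq_mul_inv, div_le_iff₀ h3]
        linarith
    _ = ∫ x in Ioc (s / 2) s, s / 2 ∂ν := by
        rw [setIntegral_const, smul_eq_mul, mul_comm]
    _ ≤ _ := by
        apply setIntegral_mono_on (integrable_const _) hint.integrableOn measurableSet_Ioc
        intro x hx; exact hx.1.le

lemma fDef_meas {μ : ℝ} {n k : ℕ} : Measurable (fDef μ n k) := by
  unfold fDef
  fun_prop

lemma fDef_intOn {ν : Measure ℝ} [IsProbabilityMeasure ν] {μ : ℝ} {n k : ℕ} (hμ : 0 < μ)
    {B : Set (Fin k → ℝ)} (hB : MeasurableSet B) (hB0 : ∀ x ∈ B, ∀ i, 0 ≤ x i) :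
    IntegrableOn (fDef μ n k) B (Measure.pi fun _ : Fin k => ν) := by
  apply Measure.integrableOn_of_bounded (M := 1) (measure_ne_top _ _)
    fDef_meas.aestronglyMeasurable
  filter_upwards [ae_restrict_mem hB] with x hx
  rw [Real.norm_eq_abs, abs_of_nonneg (fDef_nonneg hμ (hB0 x hx))]
  exact fDef_le_one hμ (hB0 x hx)

lemma meas_pi {k : ℕ} {B : Set ℝ} (hB : MeasurableSet B) :
    MeasurableSet (Set.univ.pi (fun _ : Fin k => B)) :=
  MeasurableSet.univ_pi fun _ => hB

/-- Upper bound by product function. -/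
lemma pi_upper {ν : Measure ℝ} [IsProbabilityMeasure ν] {μ s : ℝ} {n k : ℕ} (hk : 3 ≤ k)
    (hμ : 0 < μ) (hs : 0 < s) (hsq : s ^ 2 = μ * n) {p q : ℝ}
    (hp1 : 1 ≤ p) (hp2 : p ≤ 2) (hq1 : 2 * p - 2 ≤ q) (hq2 : p / 2 ≤ q)
    (hi : IntegrableOn (fun x : ℝ => phi p q (x / s)) (Ici 1) ν) :
    ∫ x in Set.univ.pi (fun _ : Fin k => Set.Ici (1 : ℝ)), fDef μ n k x
      ∂(Measure.pi fun _ : Fin k => ν) ≤ (∫ x in Ici 1, phi p q (x / s) ∂ν) ^ k := by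
  set w : ℝ → ℝ := (Ici 1).indicator (fun x => phi p q (x / s)) with hw
  have hwi : Integrable w ν := hi.integrable_indicator measurableSet_Ici
  have hw0 : ∀ x, 0 ≤ w x := fun x => Set.indicator_nonneg (fun y hy => phi_nonneg _ _
    (div_pos (by linarith [show (1 : ℝ) ≤ y from hy]) hs)) x
  have hP : Integrable (fun x : Fin k → ℝ => ∏ i, w (x i)) (Measure.pi fun _ : Fin k => ν) :=
    Integrable.fintype_prod (f := fun _ => w) (fun _ => hwi)
  have h1 : (∫ x in Ici 1, phi p q (x / s) ∂ν) ^ k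
      = ∫ x : Fin k → ℝ, ∏ i, w (x i) ∂(Measure.pi fun _ : Fin k => ν) := by
    rw [integral_fintype_prod_eq_prod (fun _ => w)]
    simp [hw, integral_indicator measurableSet_Ici]
  rw [h1, ← integral_indicator (meas_pi measurableSet_Ici)]
  apply integral_mono _ hP
  · intro x
    by_cases hx : x ∈ Set.univ.pi (fun _ : Fin k => Set.Ici (1 : ℝ))
    · have hx' : ∀ i, 1 ≤ x i := fun i => hx i (mem_univ i)
      simp only [Set.indicator_of_mem hx]
      refine (fDef_bound hk hs hsq (fun i => by linarith [hx' i]) hp1 hp2 hq1 hq2).trans ?_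
      apply le_of_eq
      refine Finset.prod_congr rfl fun i _ => ?_
      rw [hw, Set.indicator_of_mem]
      exact hx' i
    · simp only [Set.indicator_of_notMem hx]
      exact Finset.prod_nonneg fun i _ => hw0 _
  · apply IntegrableOn.integrable_indicator _ (meas_pi measurableSet_Ici)
    exact fDef_intOn hμ (meas_pi measurableSet_Ici)
      fun x hx i => zero_le_one.trans (hx i (mem_univ i))

lemma pi_lower {ν : Measure ℝ} [IsProbabilityMeasure ν] {μ s : ℝ} {n k : ℕ}
    (hμ : 0 < μ) (hs : 1 ≤ s) (hsq : s ^ 2 = μ * n) :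
    (ν (Ioi s)).toReal ^ k ≤
    ∫ x in Set.univ.pi (fun _ : Fin k => Set.Ici (1 : ℝ)), fDef μ n k x
      ∂(Measure.pi fun _ : Fin k => ν) := by
  have h1 : (ν (Ioi s)).toReal ^ k = ∫ x in Set.univ.pi (fun _ : Fin k => Set.Ioi s), (1 : ℝ)
      ∂(Measure.pi fun _ : Fin k => ν) := by
    rw [setIntegral_const, Measure.real, Measure.pi_pi]
    simp
  have h0 : ∀ x ∈ Set.univ.pi (fun _ : Fin k => Set.Ioi s), ∀ i, s < x i :=
    fun x hx i => hx i (mem_univ i)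
  have hI : IntegrableOn (fDef μ n k) (Set.univ.pi (fun _ : Fin k => Set.Ici (1 : ℝ)))
      (Measure.pi fun _ : Fin k => ν) :=
    fDef_intOn hμ (meas_pi measurableSet_Ici) fun x hx i => zero_le_one.trans (hx i (mem_univ i))
  have hsub : Set.univ.pi (fun _ : Fin k => Set.Ioi s) ⊆
      Set.univ.pi (fun _ : Fin k => Set.Ici (1 : ℝ)) :=
    fun x hx i _ => hs.trans (h0 x hx i).le
  rw [h1]
  calc _ ≤ ∫ x in Set.univ.pi (fun _ : Fin k => Set.Ioi s), fDef μ n k x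
          ∂(Measure.pi fun _ : Fin k => ν) := by
        apply setIntegral_mono_on (integrable_const _) (hI.mono_set hsub) (meas_pi measurableSet_Ioi)
        intro x hx
        apply le_of_eq
        symm
        apply Finset.prod_eq_one
        intro p _
        apply min_eq_right
        rw [← hsq, le_div_iff₀ (by positivity)]
        have a1 := h0 x hx p.1
        have a2 := h0 x hx p.2
        nlinarith
    _ ≤ _ := by
        apply setIntegral_mono_set hI
        · filter_upwards [ae_restrict_mem (meas_pi measurableSet_Ici)] with x hx
          exact fDef_nonneg hμ fun i => zero_le_one.trans (hx i (mem_univ i))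
        · exact hsub.eventuallyLE

lemma pi_diff {ν : Measure ℝ} [IsProbabilityMeasure ν] {μ s T : ℝ} {n k : ℕ} (hk : 3 ≤ k)
    (hμ : 0 < μ) (hs : 0 < s) (hT : 1 ≤ T) (hsq : s ^ 2 = μ * n) {p q : ℝ}
    (hp1 : 1 ≤ p) (hp2 : p ≤ 2) (hq1 : 2 * p - 2 ≤ q) (hq2 : p / 2 ≤ q)
    (hi : IntegrableOn (fun x : ℝ => phi p q (x / s)) (Ici 1) ν) :
    (∫ x in Set.univ.pi (fun _ : Fin k => Set.Ici (1 : ℝ)), fDef μ n k x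
      ∂(Measure.pi fun _ : Fin k => ν)) -
    (∫ x in Set.univ.pi (fun _ : Fin k => Set.Icc (1 : ℝ) T), fDef μ n k x
      ∂(Measure.pi fun _ : Fin k => ν)) ≤
      k * ((∫ x in Ioi T, phi p q (x / s) ∂ν) * (∫ x in Ici 1, phi p q (x / s) ∂ν) ^ (k - 1)) := by
  set w : ℝ → ℝ := (Ici 1).indicator (fun x => phi p q (x / s)) with hw
  set w' : ℝ → ℝ := (Ioi T).indicator (fun x => phi p q (x / s)) with hw'
  have hwi : Integrable w ν := hi.integrable_indicator measurableSet_Ici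
  have hwi' : Integrable w' ν := (hi.mono_set
    (fun x hx => hT.trans (le_of_lt hx))).integrable_indicator measurableSet_Ioi
  have hw0 : ∀ x, 0 ≤ w x := fun x => Set.indicator_nonneg (fun y hy => phi_nonneg _ _
    (div_pos (by linarith [show (1 : ℝ) ≤ y from hy]) hs)) x
  have hw0' : ∀ x, 0 ≤ w' x := fun x => Set.indicator_nonneg (fun y hy => phi_nonneg _ _
    (div_pos (by linarith [show T < y from hy]) hs)) x
  let W : Fin k → Fin k → ℝ → ℝ := fun i j => if j = i then w' else w
  have hW0 : ∀ i j x, 0 ≤ W i j x := by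
    intro i j x; simp only [W]; split_ifs
    · exact hw0' x
    · exact hw0 x
  have hP : ∀ i, Integrable (fun x : Fin k → ℝ => ∏ j, W i j (x j))
      (Measure.pi fun _ : Fin k => ν) := fun i =>
    Integrable.fintype_prod (f := W i) (fun j => by
      simp only [W]; split_ifs
      · exact hwi'
      · exact hwi)
  have hPI : ∀ i, ∫ x : Fin k → ℝ, ∏ j, W i j (x j) ∂(Measure.pi fun _ : Fin k => ν)
      = (∫ x in Ioi T, phi p q (x / s) ∂ν) * (∫ x in Ici 1, phi p q (x / s) ∂ν) ^ (k - 1) := by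
    intro i
    rw [integral_fintype_prod_eq_prod (W i), ← Finset.mul_prod_erase _ _ (Finset.mem_univ i)]
    congr 1
    · simp [W, hw', integral_indicator measurableSet_Ioi]
    · rw [Finset.prod_congr rfl (g := fun _ => ∫ x in Ici 1, phi p q (x / s) ∂ν)]
      · simp [Finset.card_erase_of_mem]
      · intro j hj
        simp [W, Finset.ne_of_mem_erase hj, hw, integral_indicator measurableSet_Ici]
  have hI : IntegrableOn (fDef μ n k) (Set.univ.pi (fun _ : Fin k => Set.Ici (1 : ℝ)))
      (Measure.pi fun _ : Fin k => ν) :=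
    fDef_intOn hμ (meas_pi measurableSet_Ici) fun x hx i => zero_le_one.trans (hx i (mem_univ i))
  have hsub : Set.univ.pi (fun _ : Fin k => Set.Icc (1 : ℝ) T) ⊆
      Set.univ.pi (fun _ : Fin k => Set.Ici (1 : ℝ)) :=
    fun x hx i hi => (hx i hi).1
  rw [← setIntegral_sdiff (meas_pi measurableSet_Icc) hI hsub]
  have : (k : ℝ) * ((∫ x in Ioi T, phi p q (x / s) ∂ν) *
      (∫ x in Ici 1, phi p q (x / s) ∂ν) ^ (k - 1))
      = ∫ x : Fin k → ℝ, ∑ i, ∏ j, W i j (x j) ∂(Measure.pi fun _ : Fin k => ν) := by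
    rw [integral_finsetSum _ fun i _ => hP i]
    simp [hPI]
  rw [this]
  have hmD : MeasurableSet (Set.univ.pi (fun _ : Fin k => Set.Ici (1 : ℝ)) \
      Set.univ.pi (fun _ : Fin k => Set.Icc (1 : ℝ) T)) :=
    (meas_pi measurableSet_Ici).diff (meas_pi measurableSet_Icc)
  rw [← integral_indicator hmD]
  apply integral_mono ((hI.mono_set sdiff_subset).integrable_indicator hmD)
    (integrable_finsetSum _ fun i _ => hP i)
  intro x
  by_cases hx : x ∈ (Set.univ.pi (fun _ : Fin k => Set.Ici (1 : ℝ)) \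
      Set.univ.pi (fun _ : Fin k => Set.Icc (1 : ℝ) T))
  · have hx' : ∀ i, 1 ≤ x i := fun i => hx.1 i (mem_univ i)
    simp only [Set.indicator_of_mem hx]
    obtain ⟨i, hi⟩ : ∃ i, T < x i := by
      by_contra hcon
      push Not at hcon
      exact hx.2 fun i _ => ⟨hx' i, hcon i⟩
    refine (fDef_bound hk hs hsq (fun i => by linarith [hx' i]) hp1 hp2 hq1 hq2).trans ?_
    refine le_trans (le_of_eq ?_) (Finset.single_le_sum
      (f := fun i => ∏ j, W i j (x j)) (fun i _ => Finset.prod_nonneg fun j _ => hW0 i j _)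
      (Finset.mem_univ i))
    refine Finset.prod_congr rfl fun j _ => ?_
    simp only [W]
    split_ifs with hj
    · subst hj
      rw [hw', Set.indicator_of_mem]
      exact hi
    · rw [hw, Set.indicator_of_mem]
      exact hx' j
  · simp only [Set.indicator_of_notMem hx]
    exact Finset.sum_nonneg fun i _ => Finset.prod_nonneg fun j _ => hW0 i j _
lemma fDef_succ (μ : ℝ) (n k : ℕ) (x : Fin (k + 1) → ℝ) :
    fDef μ n (k + 1) x = (∏ j : Fin k, min (x 0 * x j.succ / (μ * n)) 1) *
      fDef μ n k (fun j => x j.succ) := by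
  unfold fDef
  rw [Finset.prod_filter, Finset.prod_filter, Fintype.prod_prod_type, Fintype.prod_prod_type,
    Fin.prod_univ_succ]
  congr 1
  · rw [Fin.prod_univ_succ]
    simp
  · refine Finset.prod_congr rfl fun i _ => ?_
    rw [Fin.prod_univ_succ]
    simp

/-- The kernel in the two free weights. -/
lemma hub_formula (μ : ℝ) (n m : ℕ) (x y c : ℝ) :
    fDef μ n (m + 2) (hubVec (m + 2) x y c) =
      fDef μ n m (fun _ => c) * (min (x * y / (μ * n)) 1 *
        (min (x * c / (μ * n)) 1 ^ m * min (y * c / (μ * n)) 1 ^ m)) := by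
  rw [fDef_succ, fDef_succ, Fin.prod_univ_succ]
  simp [hubVec]
  ring

lemma hubVec_nonneg {k : ℕ} {x y c : ℝ} (hx : 1 ≤ x) (hy : 1 ≤ y) (hc : 0 ≤ c) :
    ∀ i, 0 ≤ hubVec k x y c i := by
  intro i; unfold hubVec; split_ifs <;> linarith

lemma hubVec_pos {k : ℕ} {x y c : ℝ} (hx : 1 ≤ x) (hy : 1 ≤ y) (hc : 0 < c) :
    ∀ i, 0 < hubVec k x y c i := by
  intro i; unfold hubVec; split_ifs <;> linarith

lemma hub_meas (μ : ℝ) (n k : ℕ) (c : ℝ) :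
    Measurable (fun z : ℝ × ℝ => fDef μ n k (hubVec k z.1 z.2 c)) := by
  apply fDef_meas.comp
  rw [measurable_pi_iff]
  intro i
  unfold hubVec
  split_ifs <;> fun_prop

lemma hub_intOn {ν : Measure ℝ} [IsProbabilityMeasure ν] {μ : ℝ} {n k : ℕ} (hμ : 0 < μ)
    {c : ℝ} (hc : 0 ≤ c) :
    IntegrableOn (fun z : ℝ × ℝ => fDef μ n k (hubVec k z.1 z.2 c)) (Ici 1 ×ˢ Ici 1)
      (ν.prod ν) := by
  apply Measure.integrableOn_of_bounded (M := 1) (measure_ne_top _ _)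
    (hub_meas _ _ _ _).aestronglyMeasurable
  filter_upwards [ae_restrict_mem (measurableSet_Ici.prod measurableSet_Ici)] with z hz
  have h := hubVec_nonneg (k := k) hz.1 hz.2 hc
  rw [Real.norm_eq_abs, abs_of_nonneg (fDef_nonneg hμ h)]
  exact fDef_le_one hμ h

lemma twoInt_eq {ν : Measure ℝ} [IsProbabilityMeasure ν] {μ : ℝ} {n k : ℕ} (hμ : 0 < μ)
    {c : ℝ} (hc : 0 ≤ c) :
    twoInt ν μ k n c = ∫ z in Ici 1 ×ˢ Ici 1, fDef μ n k (hubVec k z.1 z.2 c) ∂(ν.prod ν) := by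
  rw [setIntegral_prod _ (hub_intOn hμ hc)]
  rfl

lemma twoInt_cont {ν : Measure ℝ} [IsProbabilityMeasure ν] {μ : ℝ} {n k : ℕ} (hμ : 0 < μ)
    {c : ℝ} (hc : 0 < c) : ContinuousAt (twoInt ν μ k n) c := by
  have h1 : ContinuousAt (fun c => ∫ z in Ici 1 ×ˢ Ici 1,
      fDef μ n k (hubVec k z.1 z.2 c) ∂(ν.prod ν)) c := by
    apply continuousAt_of_dominated (bound := fun _ => 1)
    · exact Eventually.of_forall fun c => (hub_meas _ _ _ _).aestronglyMeasurable
    · filter_upwards [lt_mem_nhds hc] with d hd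
      filter_upwards [ae_restrict_mem (measurableSet_Ici.prod measurableSet_Ici)] with z hz
      have h := hubVec_nonneg (k := k) hz.1 hz.2 hd.le
      rw [Real.norm_eq_abs, abs_of_nonneg (fDef_nonneg hμ h)]
      exact fDef_le_one hμ h
    · exact integrable_const _
    · refine Eventually.of_forall fun z => Continuous.continuousAt ?_
      have : Continuous (fDef μ n k) := by unfold fDef; fun_prop
      apply this.comp
      rw [continuous_pi_iff]
      intro i
      unfold hubVec
      split_ifs <;> fun_prop
  apply h1.congr
  filter_upwards [lt_mem_nhds hc] with d hd
  exact (twoInt_eq hμ hd.le).symm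

lemma twoInt_upper {ν : Measure ℝ} [IsProbabilityMeasure ν] {μ s : ℝ} {n k : ℕ} (hk : 3 ≤ k)
    (hμ : 0 < μ) (hs : 0 < s) (hsq : s ^ 2 = μ * n) {p q : ℝ}
    (hp1 : 1 ≤ p) (hp2 : p ≤ 2) (hq1 : 2 * p - 2 ≤ q) (hq2 : p / 2 ≤ q)
    (hi : IntegrableOn (fun x : ℝ => phi p q (x / s)) (Ici 1) ν)
    {c : ℝ} (hc : 0 < c) (hcs : c ≤ s) :
    twoInt ν μ k n c ≤ (∫ x in Ici 1, phi p q (x / s) ∂ν) ^ 2 := by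
  rw [twoInt_eq hμ hc.le, sq, ← setIntegral_prod_mul]
  apply setIntegral_mono_on (hub_intOn hμ hc.le) _ (measurableSet_Ici.prod measurableSet_Ici)
  · intro z hz
    refine (fDef_bound hk hs hsq (hubVec_pos hz.1 hz.2 hc) hp1 hp2 hq1 hq2).trans ?_
    obtain ⟨m, rfl⟩ : ∃ m, k = m + 2 := ⟨k - 2, by omega⟩
    rw [Fin.prod_univ_succ, Fin.prod_univ_succ]
    have hz1 : (1 : ℝ) ≤ z.1 := hz.1
    have hz2 : (1 : ℝ) ≤ z.2 := hz.2
    have a1 : 0 ≤ phi p q (z.1 / s) := phi_nonneg _ _ (by positivity)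
    have a2 : 0 ≤ phi p q (z.2 / s) := phi_nonneg _ _ (by positivity)
    have a3 : phi p q (c / s) ≤ 1 := by
      have : c / s ≤ 1 := (div_le_one hs).2 hcs
      simp only [phi, this, if_true]
      exact Real.rpow_le_one (by positivity) this (by linarith)
    have a4 : 0 ≤ phi p q (c / s) := phi_nonneg _ _ (by positivity)
    have a5 := pow_le_one₀ a4 a3 (n := m)
    simp [hubVec]
    exact mul_le_mul_of_nonneg_left (mul_le_of_le_one_right a2 a5) a1
  · rw [IntegrableOn, ← Measure.prod_restrict]
    exact Integrable.mul_prod hi hi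

lemma twoInt_lower {ν : Measure ℝ} [IsProbabilityMeasure ν] (hsupp : ν (Set.Iio 1) = 0)
    {μ : ℝ} {n k : ℕ} (hk : 3 ≤ k) (hμ : 1 ≤ μ) (hn : 1 ≤ n) :
    1 / (μ * n) ≤ twoInt ν μ k n (μ * n) := by
  have hn' : (1 : ℝ) ≤ n := by exact_mod_cast hn
  have hN : 1 ≤ μ * n := by nlinarith
  have hN0 : 0 < μ * n := by linarith
  have hI : ν (Ici 1) = 1 := by
    have := prob_compl_eq_one_sub (μ := ν) (s := Iio (1 : ℝ)) measurableSet_Iio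
    rw [hsupp] at this
    simpa using this
  rw [twoInt_eq (by linarith) hN0.le]
  have : 1 / (μ * n) = ∫ z in (Ici (1 : ℝ)) ×ˢ (Ici (1 : ℝ)), 1 / (μ * n) ∂(ν.prod ν) := by
    rw [setIntegral_const, Measure.real, Measure.prod_prod, hI]
    simp
  rw [this]
  apply setIntegral_mono_on (integrable_const _) (hub_intOn (by linarith) hN0.le)
    (measurableSet_Ici.prod measurableSet_Ici)
  intro z hz
  have hz1 : (1 : ℝ) ≤ z.1 := hz.1
  have hz2 : (1 : ℝ) ≤ z.2 := hz.2
  obtain ⟨m, rfl⟩ : ∃ m, k = m + 2 := ⟨k - 2, by omega⟩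
  rw [hub_formula]
  have e1 : fDef μ n m (fun _ => μ * n) = 1 := by
    apply Finset.prod_eq_one
    intro p _
    apply min_eq_right
    rw [mul_div_assoc, div_self hN0.ne', mul_one]
    exact hN
  have e2 : min (z.1 * (μ * n) / (μ * n)) 1 = 1 := by
    rw [mul_div_assoc, div_self hN0.ne', mul_one]; exact min_eq_right hz1
  have e3 : min (z.2 * (μ * n) / (μ * n)) 1 = 1 := by
    rw [mul_div_assoc, div_self hN0.ne', mul_one]; exact min_eq_right hz2
  rw [e1, e2, e3]
  simp only [one_pow, mul_one, one_mul]
  apply le_min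
  · gcongr
    nlinarith
  · rw [div_le_one hN0]; exact hN

lemma inf_level {F : ℝ → ℝ} {b : ℝ} (hne : {c : ℝ | 0 < c ∧ b < F c}.Nonempty)
    (h0 : 0 < sInf {c : ℝ | 0 < c ∧ b < F c})
    (hc : ContinuousAt F (sInf {c : ℝ | 0 < c ∧ b < F c})) :
    F (sInf {c : ℝ | 0 < c ∧ b < F c}) = b := by
  set S := {c : ℝ | 0 < c ∧ b < F c} with hS
  have hb : BddBelow S := ⟨0, fun c hc => hc.1.le⟩
  apply le_antisymm
  · by_contra hlt
    push Not at hlt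
    have h1 : ∀ᶠ c in nhds (sInf S), b < F c := hc.eventually (lt_mem_nhds hlt)
    have h2 := h1.and (lt_mem_nhds h0)
    have h3 : ∀ᶠ c in nhdsWithin (sInf S) (Iio (sInf S)), (b < F c ∧ 0 < c) ∧ c < sInf S :=
      (h2.filter_mono nhdsWithin_le_nhds).and self_mem_nhdsWithin
    obtain ⟨c, ⟨hc1, hc2⟩, hc3⟩ := h3.exists
    exact absurd (csInf_le hb (show c ∈ S from ⟨hc2, hc1⟩)) (not_le.2 hc3)
  · have hm := csInf_mem_closure hne hb
    have : (nhdsWithin (sInf S) S).NeBot := mem_closure_iff_nhdsWithin_neBot.1 hm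
    refine ge_of_tendsto (hc.tendsto.mono_left (nhdsWithin_le_nhds (s := S))) ?_
    filter_upwards [self_mem_nhdsWithin] with c hc
    exact hc.2.le

lemma hub_diff {ν : Measure ℝ} [IsProbabilityMeasure ν] (hint : Integrable (fun x : ℝ => x) ν)
    {μ s T c : ℝ} {n k : ℕ} (hk : 3 ≤ k)
    (hμ : 0 < μ) (hs : 2 ≤ s) (hT : 1 ≤ T) (hsq : s ^ 2 = μ * n) (hc : s ≤ c)
    {d : ℝ} (hd : 0 < d) (hd' : d ≤ (1 / 2) ^ (k - 2) * ∫ x in Ioc (s / 2) s, x ∂ν) :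
    0 ≤ twoInt ν μ k n c - (∫ x in Set.Icc (1 : ℝ) T, ∫ y in Set.Icc (1 : ℝ) T,
        fDef μ n k (hubVec k x y c) ∂ν ∂ν) ∧
    twoInt ν μ k n c - (∫ x in Set.Icc (1 : ℝ) T, ∫ y in Set.Icc (1 : ℝ) T,
        fDef μ n k (hubVec k x y c) ∂ν ∂ν) ≤
      2 * (∫ x in Ioi T, x ∂ν) * (1 / d + (∫ x in Ioi s, x ∂ν) / d ^ 2) * twoInt ν μ k n c := by
  obtain ⟨m, rfl⟩ : ∃ m, k = m + 2 := ⟨k - 2, by omega⟩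
  simp only [Nat.add_sub_cancel] at hd'
  have hs0 : 0 < s := by linarith
  have hc0 : 0 < c := by linarith
  set N := μ * (n : ℝ) with hN
  have hN0 : 0 < N := by rw [← hsq]; positivity
  set K := fDef μ n m (fun _ => c) with hK
  have hK0 : 0 ≤ K := fDef_nonneg hμ fun _ => hc0.le
  set ψ : ℝ → ℝ := fun x => min (x * c / N) 1 ^ m with hψ
  have hψ0 : ∀ x, 0 ≤ x → 0 ≤ ψ x := fun x hx => by
    have : 0 ≤ min (x * c / N) 1 := le_min (by positivity) zero_le_one
    positivity
  have hψ1 : ∀ x, 0 ≤ x → ψ x ≤ 1 := fun x hx =>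
    pow_le_one₀ (le_min (by positivity) zero_le_one) (min_le_right _ _)
  have hψm : Measurable ψ := by fun_prop
  have hform : ∀ x y, fDef μ n (m + 2) (hubVec (m + 2) x y c) =
      K * (min (x * y / N) 1 * (ψ x * ψ y)) := fun x y => hub_formula μ n m x y c
  -- integrability
  have hiB : IntegrableOn (fun x => ψ x * x) (Ici 1) ν := by
    have hm : Measurable (fun x => ψ x * x) := hψm.mul measurable_id
    apply Integrable.mono' hint.integrableOn hm.aestronglyMeasurable
    filter_upwards [ae_restrict_mem measurableSet_Ici] with x hx
    have hx0 : (0 : ℝ) ≤ x := zero_le_one.trans hx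
    rw [Real.norm_eq_abs, abs_of_nonneg (mul_nonneg (hψ0 x hx0) hx0)]
    exact mul_le_of_le_one_left hx0 (hψ1 x hx0)
  set B := ∫ x in Ici 1, ψ x * x ∂ν with hB
  set b := ∫ x in Icc 1 s, ψ x * x ∂ν with hb
  set As := ∫ x in Ioi s, x ∂ν with hAs
  set AT := ∫ x in Ioi T, x ∂ν with hAT
  have hAs0 : 0 ≤ As := setIntegral_nonneg measurableSet_Ioi fun x hx => (hs0.trans hx).le
  have hAT0 : 0 ≤ AT := setIntegral_nonneg measurableSet_Ioi fun x hx => by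
    linarith [show T < x from hx]
  have hB0 : 0 ≤ B := setIntegral_nonneg measurableSet_Ici fun x hx => by
    have hx0 : (0 : ℝ) ≤ x := zero_le_one.trans hx
    exact mul_nonneg (hψ0 x hx0) hx0
  have hBb : B ≤ b + As := by
    have hU : Ici 1 = Icc 1 s ∪ Ioi s := (Icc_union_Ioi_eq_Ici (by linarith)).symm
    have hdis : Disjoint (Icc 1 s) (Ioi s) := by
      rw [Set.disjoint_left]; intro x h1 h2; exact not_lt.2 h1.2 h2
    have hsub : Ioi s ⊆ Ici 1 := fun x hx => by
      have : s < x := hx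
      exact (by linarith : (1 : ℝ) ≤ x)
    rw [hB, hU, setIntegral_union hdis measurableSet_Ioi (hiB.mono_set fun x hx => hx.1)
      (hiB.mono_set hsub)]
    gcongr
    apply setIntegral_mono_on (hiB.mono_set hsub) hint.integrableOn measurableSet_Ioi
    intro x hx
    have hx0 : 0 ≤ x := (hs0.trans hx).le
    exact mul_le_of_le_one_left hx0 (hψ1 x hx0)
  have hdb : d ≤ b := by
    refine hd'.trans ?_
    rw [← integral_const_mul]
    calc _ ≤ ∫ x in Ioc (s / 2) s, ψ x * x ∂ν := by
          apply setIntegral_mono_on (hint.integrableOn.const_mul _)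
            (hiB.mono_set fun x hx => by
              have : s / 2 < x := hx.1
              exact (by linarith : (1 : ℝ) ≤ x)) measurableSet_Ioc
          intro x hx
          have h1 : s / 2 < x := hx.1
          have hx0 : 0 ≤ x := by linarith
          have : (1 / 2 : ℝ) ≤ min (x * c / N) 1 := by
            apply le_min _ (by norm_num)
            rw [le_div_iff₀ hN0, ← hsq]
            nlinarith
          apply mul_le_mul_of_nonneg_right _ hx0
          exact pow_le_pow_left₀ (by norm_num) this m
      _ ≤ _ := by
          apply setIntegral_mono_set (hiB.mono_set fun x hx => hx.1)
          · filter_upwards [ae_restrict_mem measurableSet_Icc] with x hx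
            have hx0 : (0 : ℝ) ≤ x := zero_le_one.trans hx.1
            exact mul_nonneg (hψ0 x hx0) hx0
          · apply LE.le.eventuallyLE
            intro x hx
            have : s / 2 < x := hx.1
            exact ⟨by linarith, hx.2⟩
  have hb0 : 0 < b := lt_of_lt_of_le hd hdb
  have hI := hub_intOn (ν := ν) (n := n) (k := m + 2) hμ hc0.le
  have hmQ : MeasurableSet ((Ici (1 : ℝ)) ×ˢ (Ici (1 : ℝ))) :=
    measurableSet_Ici.prod measurableSet_Ici
  have hmT : MeasurableSet ((Icc (1 : ℝ) T) ×ˢ (Icc (1 : ℝ) T)) :=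
    measurableSet_Icc.prod measurableSet_Icc
  have hsubT : (Icc (1 : ℝ) T) ×ˢ (Icc (1 : ℝ) T) ⊆ (Ici (1 : ℝ)) ×ˢ (Ici (1 : ℝ)) :=
    Set.prod_mono (fun x hx => hx.1) (fun x hx => hx.1)
  have hJT : (∫ x in Set.Icc (1 : ℝ) T, ∫ y in Set.Icc (1 : ℝ) T,
        fDef μ n (m + 2) (hubVec (m + 2) x y c) ∂ν ∂ν) =
      ∫ z in (Icc (1 : ℝ) T) ×ˢ (Icc (1 : ℝ) T),
        fDef μ n (m + 2) (hubVec (m + 2) z.1 z.2 c) ∂(ν.prod ν) := by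
    rw [setIntegral_prod _ (hI.mono_set hsubT)]
  have hpos : ∀ z ∈ (Ici (1 : ℝ)) ×ˢ (Ici (1 : ℝ)),
      0 ≤ fDef μ n (m + 2) (hubVec (m + 2) z.1 z.2 c) := fun z hz =>
    fDef_nonneg hμ (hubVec_nonneg hz.1 hz.2 hc0.le)
  -- lower bound of full integral
  have hJlow : K / N * b ^ 2 ≤ twoInt ν μ (m + 2) n c := by
    have hsubs : (Icc (1 : ℝ) s) ×ˢ (Icc (1 : ℝ) s) ⊆ (Ici (1 : ℝ)) ×ˢ (Ici (1 : ℝ)) :=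
      Set.prod_mono (fun x hx => hx.1) (fun x hx => hx.1)
    rw [twoInt_eq hμ hc0.le, sq, hb, ← setIntegral_prod_mul, ← integral_const_mul]
    calc _ ≤ ∫ z in (Icc (1 : ℝ) s) ×ˢ (Icc (1 : ℝ) s),
          fDef μ n (m + 2) (hubVec (m + 2) z.1 z.2 c) ∂(ν.prod ν) := by
          apply setIntegral_mono_on _ (hI.mono_set hsubs)
            (measurableSet_Icc.prod measurableSet_Icc)
          · intro z hz
            rw [hform]
            have h1 : (1 : ℝ) ≤ z.1 := hz.1.1
            have h2 : (1 : ℝ) ≤ z.2 := hz.2.1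
            have h3 : z.1 ≤ s := hz.1.2
            have h4 : z.2 ≤ s := hz.2.2
            have : min (z.1 * z.2 / N) 1 = z.1 * z.2 / N := by
              apply min_eq_left
              rw [div_le_one hN0, ← hsq]
              nlinarith
            rw [this]
            apply le_of_eq
            field_simp
          · apply Integrable.const_mul
            rw [← Measure.prod_restrict]
            exact Integrable.mul_prod (hiB.mono_set fun x hx => hx.1)
              (hiB.mono_set fun x hx => hx.1)
      _ ≤ _ := by
          apply setIntegral_mono_set hI
          · filter_upwards [ae_restrict_mem hmQ] with z hz using hpos z hz
          · exact hsubs.eventuallyLE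
  have hJ0 : 0 ≤ twoInt ν μ (m + 2) n c := by
    refine le_trans ?_ hJlow
    positivity
  -- upper bound of difference
  have hup : twoInt ν μ (m + 2) n c - (∫ x in Set.Icc (1 : ℝ) T, ∫ y in Set.Icc (1 : ℝ) T,
        fDef μ n (m + 2) (hubVec (m + 2) x y c) ∂ν ∂ν) ≤ K / N * (2 * (AT * B)) := by
    rw [hJT, twoInt_eq hμ hc0.le, ← setIntegral_sdiff hmT hI hsubT]
    set w : ℝ → ℝ := (Ioi T).indicator (fun x => x) with hw
    set v : ℝ → ℝ := (Ici 1).indicator (fun x => ψ x * x) with hv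
    have hwi : Integrable w ν := hint.integrableOn.integrable_indicator measurableSet_Ioi
    have hvi : Integrable v ν := hiB.integrable_indicator measurableSet_Ici
    have hw0 : ∀ x, 0 ≤ w x := fun x => Set.indicator_nonneg (fun y hy => by
      linarith [show T < y from hy]) x
    have hv0 : ∀ x, 0 ≤ v x := fun x => Set.indicator_nonneg (fun y hy => by
      have : (1 : ℝ) ≤ y := hy
      exact mul_nonneg (hψ0 y (by linarith)) (by linarith)) x
    have eA : AT = ∫ x, w x ∂ν := by rw [hw, integral_indicator measurableSet_Ioi]
    have eB : B = ∫ x, v x ∂ν := by rw [hv, integral_indicator measurableSet_Ici]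
    have i1 : Integrable (fun z : ℝ × ℝ => w z.1 * v z.2) (ν.prod ν) := hwi.mul_prod hvi
    have i2 : Integrable (fun z : ℝ × ℝ => v z.1 * w z.2) (ν.prod ν) := hvi.mul_prod hwi
    have e : K / N * (2 * (AT * B)) =
        ∫ z : ℝ × ℝ, K / N * (w z.1 * v z.2 + v z.1 * w z.2) ∂(ν.prod ν) := by
      rw [integral_const_mul, integral_add i1 i2, integral_prod_mul, integral_prod_mul, eA, eB]
      ring
    rw [e, ← integral_indicator (hmQ.diff hmT)]
    apply integral_mono ((hI.mono_set sdiff_subset).integrable_indicator (hmQ.diff hmT))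
      ((i1.add i2).const_mul _)
    intro z
    change _ ≤ K / N * (w z.1 * v z.2 + v z.1 * w z.2)
    by_cases hz : z ∈ (Ici (1 : ℝ)) ×ˢ (Ici (1 : ℝ)) \ (Icc (1 : ℝ) T) ×ˢ (Icc (1 : ℝ) T)
    · simp only [Set.indicator_of_mem hz]
      have h1 : (1 : ℝ) ≤ z.1 := hz.1.1
      have h2 : (1 : ℝ) ≤ z.2 := hz.1.2
      rw [hform]
      have p1 := hψ0 z.1 (by linarith)
      have p2 := hψ0 z.2 (by linarith)
      have q1 := hψ1 z.1 (by linarith)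
      have q2 := hψ1 z.2 (by linarith)
      have v1 : v z.1 = ψ z.1 * z.1 := by rw [hv, Set.indicator_of_mem]; exact h1
      have v2 : v z.2 = ψ z.2 * z.2 := by rw [hv, Set.indicator_of_mem]; exact h2
      have main : z.1 * z.2 * (ψ z.1 * ψ z.2) ≤ w z.1 * v z.2 + v z.1 * w z.2 := by
        rcases lt_or_ge T z.1 with hT1 | hT1
        · have w1 : w z.1 = z.1 := by rw [hw, Set.indicator_of_mem]; exact hT1
          have : 0 ≤ v z.1 * w z.2 := mul_nonneg (hv0 _) (hw0 _)
          rw [w1, v2]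
          have : z.1 * z.2 * (ψ z.1 * ψ z.2) ≤ z.1 * z.2 * (1 * ψ z.2) := by gcongr
          linarith
        · have hT2 : T < z.2 := by
            by_contra hcon
            exact hz.2 ⟨⟨h1, hT1⟩, ⟨h2, not_lt.1 hcon⟩⟩
          have w1 : w z.2 = z.2 := by rw [hw, Set.indicator_of_mem]; exact hT2
          have : 0 ≤ w z.1 * v z.2 := mul_nonneg (hw0 _) (hv0 _)
          rw [w1, v1]
          have : z.1 * z.2 * (ψ z.1 * ψ z.2) ≤ z.1 * z.2 * (ψ z.1 * 1) := by gcongr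
          linarith
      calc _ ≤ K * (z.1 * z.2 / N * (ψ z.1 * ψ z.2)) := by
            gcongr
            exact min_le_left _ _
        _ = K / N * (z.1 * z.2 * (ψ z.1 * ψ z.2)) := by ring
        _ ≤ _ := by gcongr
    · simp only [Set.indicator_of_notMem hz]
      have := hw0 z.1
      have := hw0 z.2
      have := hv0 z.1
      have := hv0 z.2
      positivity
  constructor
  · rw [hJT, twoInt_eq hμ hc0.le, ← setIntegral_sdiff hmT hI hsubT]
    exact setIntegral_nonneg (hmQ.diff hmT) fun z hz => hpos z hz.1
  · refine hup.trans ?_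
    have k1 : K / N ≤ twoInt ν μ (m + 2) n c / b ^ 2 := by
      rw [le_div_iff₀ (by positivity)]; exact hJlow
    calc K / N * (2 * (AT * B)) ≤ twoInt ν μ (m + 2) n c / b ^ 2 * (2 * (AT * (b + As))) := by
          gcongr
      _ = 2 * AT * (1 / b + As / b ^ 2) * twoInt ν μ (m + 2) n c := by
          field_simp
      _ ≤ _ := by gcongr
lemma choose_div_pow (k : ℕ) :
    Tendsto (fun n : ℕ => (n.choose k : ℝ) / (n : ℝ) ^ k) atTop (nhds (1 / (k.factorial : ℝ))) := by
  have h := (isEquivalent_choose k)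
  have h2 := h.div (Asymptotics.IsEquivalent.refl (u := fun n : ℕ => (n : ℝ) ^ k))
  refine h2.symm.tendsto_nhds ?_
  apply tendsto_const_nhds.congr'
  filter_upwards [eventually_gt_atTop 0] with n hn
  have : (n : ℝ) ≠ 0 := by positivity
  simp only [Pi.div_apply]
  field_simp

lemma sub_div_tendsto (c : ℝ) :
    Tendsto (fun n : ℕ => ((n : ℝ) - c) / n) atTop (nhds 1) := by
  have h : Tendsto (fun n : ℕ => 1 - c / (n : ℝ)) atTop (nhds (1 - 0)) :=
    tendsto_const_nhds.sub (tendsto_const_div_atTop_nhds_zero_nat c)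
  rw [sub_zero] at h
  apply h.congr'
  filter_upwards [eventually_gt_atTop 0] with n hn
  have : (n : ℝ) ≠ 0 := by positivity
  field_simp

lemma choose_ratio (k l : ℕ) :
    Tendsto (fun n : ℕ => ((n - l).choose k : ℝ) / (n.choose k : ℝ)) atTop (nhds 1) := by
  have h1 := (choose_div_pow k).comp (tendsto_sub_atTop_nat l)
  have h2 := (sub_div_tendsto (l : ℝ)).pow k
  have h3 := choose_div_pow k
  have hf : (1 : ℝ) / (k.factorial : ℝ) ≠ 0 := by
    have := Nat.factorial_pos k
    positivity
  have h4 := (h1.mul h2).div h3 hf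
  rw [one_pow, mul_one, div_self hf] at h4
  apply h4.congr'
  filter_upwards [eventually_gt_atTop (l + k)] with n hn
  have e1 : (n : ℝ) ≠ 0 := by
    have : 0 < n := by omega
    positivity
  have e2 : ((n - l : ℕ) : ℝ) = (n : ℝ) - l := by
    rw [Nat.cast_sub (by omega)]
  have e3 : (n : ℝ) - l ≠ 0 := by
    rw [← e2]
    have : 0 < n - l := by omega
    positivity
  have e4 : (n.choose k : ℝ) ≠ 0 := by
    have : 0 < n.choose k := Nat.choose_pos (by omega)
    positivity
  simp only [Function.comp, Pi.div_apply, e2, div_pow]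
  field_simp

lemma half_ratio (c : ℝ) :
    Tendsto (fun n : ℕ => (1 : ℝ) / 2 * ((n : ℝ) - c) ^ 2 / (n.choose 2 : ℝ)) atTop (nhds 1) := by
  have h2 := ((sub_div_tendsto c).pow 2).const_mul (1 / 2 : ℝ)
  have h3 := choose_div_pow 2
  have h4 := h2.div h3 (by norm_num [Nat.factorial])
  have : (1 / 2 * 1 ^ 2 / (1 / ((2 : ℕ).factorial : ℝ)) : ℝ) = 1 := by norm_num [Nat.factorial]
  rw [this] at h4
  apply h4.congr'
  filter_upwards [eventually_gt_atTop 2] with n hn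
  have e1 : (n : ℝ) ≠ 0 := by
    have : 0 < n := by omega
    positivity
  have e4 : (n.choose 2 : ℝ) ≠ 0 := by
    have : 0 < n.choose 2 := Nat.choose_pos (by omega)
    positivity
  simp only [Pi.div_apply, div_pow]
  field_simp

lemma choose_lower (k : ℕ) :
    ∀ᶠ n : ℕ in atTop, 1 / (2 * (k.factorial : ℝ)) * (n : ℝ) ^ k ≤ (n.choose k : ℝ) := by
  have hf : (0 : ℝ) < k.factorial := by exact_mod_cast Nat.factorial_pos k
  have h : 1 / (2 * (k.factorial : ℝ)) < 1 / (k.factorial : ℝ) := by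
    apply one_div_lt_one_div_of_lt hf
    linarith
  filter_upwards [(choose_div_pow k).eventually_const_lt h, eventually_gt_atTop 0] with n h1 h2
  have : (0 : ℝ) < (n : ℝ) ^ k := by positivity
  exact ((lt_div_iff₀ this).1 h1).le

lemma choose_upper (k n : ℕ) : (n.choose k : ℝ) ≤ (n : ℝ) ^ k := by
  exact_mod_cast Nat.choose_le_pow n k

lemma ratio_tendsto {A B e : ℕ → ℝ} (h0 : ∀ᶠ n in atTop, 0 < A n)
    (h1 : ∀ᶠ n in atTop, 0 ≤ A n - B n) (h2 : ∀ᶠ n in atTop, A n - B n ≤ e n * A n)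
    (he : Tendsto e atTop (nhds 0)) : Tendsto (fun n => B n / A n) atTop (nhds 1) := by
  have : Tendsto (fun n => 1 - (A n - B n) / A n) atTop (nhds (1 - 0)) := by
    apply tendsto_const_nhds.sub
    refine squeeze_zero' ?_ ?_ he
    · filter_upwards [h0, h1] with n a b
      positivity
    · filter_upwards [h0, h2] with n a b
      rwa [div_le_iff₀ a]
  rw [sub_zero] at this
  apply this.congr'
  filter_upwards [h0] with n a
  field_simp
  ring

lemma mu_ge {ν : Measure ℝ} [IsProbabilityMeasure ν] (hsupp : ν (Set.Iio 1) = 0)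
    (hint : Integrable (fun x : ℝ => x) ν) : 1 ≤ ∫ x, x ∂ν := by
  have : (1 : ℝ) = ∫ x, (1 : ℝ) ∂ν := by simp
  rw [this]
  apply integral_mono_ae (integrable_const _) hint
  rw [Filter.EventuallyLE, ae_iff]
  simpa [Iio] using hsupp

lemma s_tendsto {μ : ℝ} (hμ : 0 < μ) : Tendsto (fun n : ℕ => √(μ * n)) atTop atTop :=
  Real.tendsto_sqrt_atTop.comp (tendsto_natCast_atTop_atTop.const_mul_atTop hμ)

lemma Ts_tendsto {μ δ : ℝ} (hμ : 0 < μ) (hδ : 0 < δ) :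
    Tendsto (fun n : ℕ => (n : ℝ) ^ ((1 : ℝ) / 2 + δ) / √(μ * n)) atTop atTop := by
  have h := ((tendsto_rpow_atTop hδ).comp tendsto_natCast_atTop_atTop).atTop_div_const
    (Real.sqrt_pos.2 hμ)
  apply h.congr'
  filter_upwards [eventually_gt_atTop 0] with n hn
  have hn' : (0 : ℝ) < n := by positivity
  simp only [Function.comp]
  rw [Real.rpow_add hn', Real.sqrt_mul hμ.le, ← Real.sqrt_eq_rpow]
  have := Real.sqrt_pos.2 hn'
  have := Real.sqrt_pos.2 hμ
  field_simp

/-- Collected analytic facts, eventually in `n`. -/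
lemma key_facts
    (α : ℝ) (hα : α ∈ Set.Ioo (1 : ℝ) 2)
    (ν : Measure ℝ) [IsProbabilityMeasure ν]
    (htail : Tendsto (fun x : ℝ => x ^ α * (ν (Set.Ioi x)).toReal) atTop (nhds 1))
    (g : ℝ → ℝ)
    (hdens : ν = MeasureTheory.volume.withDensity (fun x => ENNReal.ofReal (g x)))
    (hgtail : Tendsto (fun x : ℝ => g x * x ^ (α + 1)) atTop (nhds α))
    (μ : ℝ) (hμ : 0 < μ) (k : ℕ) (hk : 3 ≤ k) (δ : ℝ) (hδ : 0 < δ) :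
    ∃ C ε : ℝ, 0 < C ∧ 0 < ε ∧ ∀ᶠ n : ℕ in atTop,
      (1 / 2 * √(μ * n) ^ (-α)) ^ k ≤
        (∫ x in Set.univ.pi (fun _ : Fin k => Set.Ici (1 : ℝ)), fDef μ n k x
          ∂(Measure.pi fun _ : Fin k => ν)) ∧
      (∫ x in Set.univ.pi (fun _ : Fin k => Set.Ici (1 : ℝ)), fDef μ n k x
          ∂(Measure.pi fun _ : Fin k => ν)) ≤ (C * √(μ * n) ^ (-α)) ^ k ∧
      (∀ c, 0 < c → c ≤ √(μ * n) → twoInt ν μ k n c ≤ (C * √(μ * n) ^ (-α)) ^ 2) ∧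
      0 ≤ (∫ x in Set.univ.pi (fun _ : Fin k => Set.Ici (1 : ℝ)), fDef μ n k x
          ∂(Measure.pi fun _ : Fin k => ν)) -
        (∫ x in Set.univ.pi (fun _ : Fin k => Set.Icc (1 : ℝ) ((n : ℝ) ^ ((1 : ℝ) / 2 + δ))),
          fDef μ n k x ∂(Measure.pi fun _ : Fin k => ν)) ∧
      (∫ x in Set.univ.pi (fun _ : Fin k => Set.Ici (1 : ℝ)), fDef μ n k x
          ∂(Measure.pi fun _ : Fin k => ν)) -
        (∫ x in Set.univ.pi (fun _ : Fin k => Set.Icc (1 : ℝ) ((n : ℝ) ^ ((1 : ℝ) / 2 + δ))),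
          fDef μ n k x ∂(Measure.pi fun _ : Fin k => ν)) ≤
        k * (C * √(μ * n) ^ (-α)) ^ k * ((n : ℝ) ^ ((1 : ℝ) / 2 + δ) / √(μ * n)) ^ (-ε) := by
  obtain ⟨hα1, hα2⟩ := hα
  obtain ⟨x0, hx0, hg⟩ := g_bound hgtail
  set ε := (2 - α) / 4 with hε
  have hε0 : 0 < ε := by rw [hε]; linarith
  have hp1 : 1 ≤ α + ε := by linarith
  have hp2 : α + ε ≤ 2 := by rw [hε]; linarith
  have hq1 : 2 * (α + ε) - 2 ≤ α - ε := by rw [hε]; linarith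
  have hq2 : (α + ε) / 2 ≤ α - ε := by rw [hε]; linarith
  obtain ⟨C, hC, hmom⟩ := phi_moment hα1 hdens hx0 hg (p := α + ε) (q := α - ε)
    (by linarith) (by linarith)
  refine ⟨C, ε, hC, hε0, ?_⟩
  have hs := s_tendsto hμ
  filter_upwards [hs.eventually_ge_atTop x0, (Ts_tendsto hμ hδ).eventually_ge_atTop 1,
    hs.eventually (tail_lower htail)] with n h1 h2 h3
  set s := √(μ * n) with hsdef
  set T := (n : ℝ) ^ ((1 : ℝ) / 2 + δ) with hTdef
  have hs1 : 1 ≤ s := hx0.trans h1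
  have hs0 : 0 < s := by linarith
  have hsT : s ≤ T := (one_le_div hs0).1 h2
  have hT0 : 0 < T := by linarith
  have hsq : s ^ 2 = μ * n := Real.sq_sqrt (by positivity)
  obtain ⟨hi, hm1, hm2⟩ := hmom s h1
  have hph0 : 0 ≤ ∫ x in Ici 1, phi (α + ε) (α - ε) (x / s) ∂ν :=
    setIntegral_nonneg measurableSet_Ici fun x hx => phi_nonneg _ _
      (div_pos (lt_of_lt_of_le one_pos hx) hs0)
  have hI : IntegrableOn (fDef μ n k) (Set.univ.pi (fun _ : Fin k => Set.Ici (1 : ℝ)))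
      (Measure.pi fun _ : Fin k => ν) :=
    fDef_intOn hμ (meas_pi measurableSet_Ici) fun x hx i => zero_le_one.trans (hx i (mem_univ i))
  refine ⟨?_, ?_, ?_, ?_, ?_⟩
  · refine le_trans ?_ (pi_lower hμ hs1 hsq)
    apply pow_le_pow_left₀ (by positivity) h3
  · exact (pi_upper hk hμ hs0 hsq hp1 hp2 hq1 hq2 hi).trans (pow_le_pow_left₀ hph0 hm1 k)
  · intro c hc hcs
    exact (twoInt_upper hk hμ hs0 hsq hp1 hp2 hq1 hq2 hi hc hcs).trans (pow_le_pow_left₀ hph0 hm1 2)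
  · rw [sub_nonneg]
    apply setIntegral_mono_set hI
    · filter_upwards [ae_restrict_mem (meas_pi measurableSet_Ici)] with x hx
      exact fDef_nonneg hμ fun i => zero_le_one.trans (hx i (mem_univ i))
    · apply LE.le.eventuallyLE
      exact fun x hx i hi => (hx i hi).1
  · refine (pi_diff hk hμ hs0 (hs1.trans hsT) hsq hp1 hp2 hq1 hq2 hi).trans ?_
    rw [mul_assoc]
    refine mul_le_mul_of_nonneg_left ?_ (Nat.cast_nonneg k)
    have e : (C * s ^ (-α)) ^ k * (T / s) ^ (-ε)
        = (C * s ^ (-(α - ε)) * T ^ (α - ε - α)) * (C * s ^ (-α)) ^ (k - 1) := by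
      obtain ⟨j, rfl⟩ : ∃ j, k = j + 1 := ⟨k - 1, by omega⟩
      rw [Nat.add_sub_cancel, pow_succ, Real.div_rpow hT0.le hs0.le,
        show -(α - ε) = -α - (-ε) by ring, Real.rpow_sub hs0, show α - ε - α = -ε by ring]
      ring
    rw [e]
    have := hm2 T hsT
    gcongr

lemma num_one {α : ℝ} {k : ℕ} (hk : 3 ≤ k) (hα2 : 2 - 2 / (k : ℝ) < α) (K : ℝ) {L : ℝ}
    (hL : 0 < L) : ∀ᶠ s : ℝ in atTop, K * (s ^ (2 - α)) ^ k < L * s ^ 2 := by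
  have hk0 : (0 : ℝ) < k := by exact_mod_cast (by omega : 0 < k)
  have hy : 0 < 2 - (2 - α) * k := by
    have h : 2 - α < 2 / k := by linarith
    rw [lt_div_iff₀ hk0] at h
    linarith
  have h1 : Tendsto (fun s : ℝ => K * s ^ (-(2 - (2 - α) * k))) atTop (nhds (K * 0)) :=
    (tendsto_rpow_neg_atTop hy).const_mul K
  rw [mul_zero] at h1
  filter_upwards [h1.eventually_lt_const hL, eventually_gt_atTop 0] with s h2 hs
  have e : (s ^ (2 - α)) ^ k = s ^ (-(2 - (2 - α) * k)) * s ^ 2 := by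
    rw [← Real.rpow_natCast, ← Real.rpow_mul hs.le, ← Real.rpow_natCast s 2, ← Real.rpow_add hs]
    congr 1
    push_cast
    ring
  rw [e, ← mul_assoc]
  exact mul_lt_mul_of_pos_right h2 (by positivity)

lemma num_two {α : ℝ} (hα : α < 2) {k : ℕ} (hk : 3 ≤ k) (K : ℝ) {L : ℝ}
    (hL : 0 < L) : ∀ᶠ s : ℝ in atTop, K * (s ^ (2 - α)) ^ 2 ≤ L * (s ^ (2 - α)) ^ k := by
  have h1 : Tendsto (fun s : ℝ => L * s ^ (2 - α)) atTop atTop :=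
    (tendsto_rpow_atTop (by linarith)).const_mul_atTop hL
  filter_upwards [h1.eventually_ge_atTop K, eventually_ge_atTop 1] with s h2 hs
  have hr : 1 ≤ s ^ (2 - α) := Real.one_le_rpow hs (by linarith)
  obtain ⟨j, rfl⟩ : ∃ j, k = j + 1 + 2 := ⟨k - 3, by omega⟩
  rw [pow_add _ (j + 1) 2, ← mul_assoc]
  refine mul_le_mul_of_nonneg_right (h2.trans ?_) (by positivity)
  refine mul_le_mul_of_nonneg_left ?_ hL.le
  exact le_self_pow₀ hr (by omega)

lemma level_facts
    (α : ℝ) (hα : α ∈ Set.Ioo (1 : ℝ) 2)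
    (ν : Measure ℝ) [IsProbabilityMeasure ν]
    (hsupp : ν (Set.Iio 1) = 0)
    (μ : ℝ) (hμ : 1 ≤ μ) (k : ℕ) (hk : 3 ≤ k) (hα2 : 2 - 2 / (k : ℝ) < α)
    (a : ℝ) (ha : 0 < a) (C : ℝ) (hC : 0 < C)
    (hI : ∀ᶠ n : ℕ in atTop,
      (1 / 2 * √(μ * n) ^ (-α)) ^ k ≤
        (∫ x in Set.univ.pi (fun _ : Fin k => Set.Ici (1 : ℝ)), fDef μ n k x
          ∂(Measure.pi fun _ : Fin k => ν)) ∧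
      (∫ x in Set.univ.pi (fun _ : Fin k => Set.Ici (1 : ℝ)), fDef μ n k x
          ∂(Measure.pi fun _ : Fin k => ν)) ≤ (C * √(μ * n) ^ (-α)) ^ k ∧
      (∀ c, 0 < c → c ≤ √(μ * n) → twoInt ν μ k n c ≤ (C * √(μ * n) ^ (-α)) ^ 2)) :
    ∀ᶠ n : ℕ in atTop, √(μ * n) ≤ cA ν μ k a n ∧
      (n.choose 2 : ℝ) * twoInt ν μ k n (cA ν μ k a n) = a * mExp ν μ k n ∧
      0 < mExp ν μ k n := by
  have hμ0 : 0 < μ := by linarith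
  have hst := s_tendsto hμ0
  have n1 := hst.eventually (num_one hk hα2 (a * (C / μ) ^ k)
    (show 0 < 1 / (4 * μ ^ 2) by positivity))
  have n2 := hst.eventually (num_two hα.2 hk ((C / μ) ^ 2)
    (show 0 < a * (1 / (2 * (k.factorial : ℝ))) * (1 / (2 * μ)) ^ k by positivity))
  filter_upwards [hI, n1, n2, choose_lower k, choose_lower 2, eventually_ge_atTop 1]
    with n ⟨i1, i2, i3⟩ n1 n2 c1 c2 hn
  have hn' : (0 : ℝ) < n := by exact_mod_cast hn
  have hsq : √(μ * n) ^ 2 = μ * n := Real.sq_sqrt (by positivity)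
  have hs0 : 0 < √(μ * n) := Real.sqrt_pos.2 (by positivity)
  set s := √(μ * n) with hs
  have hr : s ^ (2 - α) = μ * n * s ^ (-α) := by
    rw [sub_eq_add_neg, Real.rpow_add hs0, ← hsq]
    norm_num
  have hp : 0 < s ^ (-α) := Real.rpow_pos_of_pos hs0 _
  have hm : mExp ν μ k n = (n.choose k : ℝ) * ∫ x in Set.univ.pi (fun _ : Fin k => Set.Ici (1 : ℝ)),
      fDef μ n k x ∂(Measure.pi fun _ : Fin k => ν) := rfl
  set I := ∫ x in Set.univ.pi (fun _ : Fin k => Set.Ici (1 : ℝ)),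
      fDef μ n k x ∂(Measure.pi fun _ : Fin k => ν) with hIdef
  have hI0 : 0 < I := lt_of_lt_of_le (by positivity) i1
  have hch0 : 0 < (n.choose k : ℝ) := lt_of_lt_of_le (by positivity) c1
  have hm0 : 0 < mExp ν μ k n := by rw [hm]; positivity
  have hch2 : 0 < (n.choose 2 : ℝ) := lt_of_lt_of_le (by positivity) c2
  have hne : {c : ℝ | 0 < c ∧ a * mExp ν μ k n < (n.choose 2 : ℝ) * twoInt ν μ k n c}.Nonempty := by
    refine ⟨μ * n, by positivity, ?_⟩
    have t := twoInt_lower (k := k) hsupp hk hμ hn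
    calc a * mExp ν μ k n ≤ a * ((n : ℝ) ^ k * (C * s ^ (-α)) ^ k) := by
          rw [hm]
          have := choose_upper k n
          gcongr
      _ = a * (C / μ) ^ k * (s ^ (2 - α)) ^ k := by
          rw [hr, ← mul_pow, mul_assoc a, ← mul_pow]
          congr 2
          field_simp
      _ < 1 / (4 * μ ^ 2) * s ^ 2 := n1
      _ = 1 / (2 * (Nat.factorial 2 : ℝ)) * (n : ℝ) ^ 2 * (1 / (μ * n)) := by
          rw [hsq]
          norm_num [Nat.factorial]
          field_simp
      _ ≤ _ := by gcongr
  have hlow : s ≤ cA ν μ k a n := by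
    refine le_csInf hne fun c hc => ?_
    by_contra hlt
    push Not at hlt
    have t := i3 c hc.1 hlt.le
    refine absurd hc.2 (not_lt.2 ?_)
    calc (n.choose 2 : ℝ) * twoInt ν μ k n c ≤ (n : ℝ) ^ 2 * (C * s ^ (-α)) ^ 2 := by
          have h1 := choose_upper 2 n
          exact (mul_le_mul_of_nonneg_left t hch2.le).trans
            (mul_le_mul_of_nonneg_right h1 (sq_nonneg _))
      _ = (C / μ) ^ 2 * (s ^ (2 - α)) ^ 2 := by
          rw [hr]
          field_simp
      _ ≤ a * (1 / (2 * (k.factorial : ℝ))) * (1 / (2 * μ)) ^ k * (s ^ (2 - α)) ^ k := n2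
      _ = a * (1 / (2 * (k.factorial : ℝ)) * (n : ℝ) ^ k * (1 / 2 * s ^ (-α)) ^ k) := by
          rw [hr, mul_assoc _ ((1 / (2 * μ)) ^ k), ← mul_pow, mul_assoc _ ((n : ℝ) ^ k), ← mul_pow,
            mul_assoc a]
          congr 3
          field_simp
      _ ≤ a * mExp ν μ k n := by
          rw [hm]
          gcongr
  refine ⟨hlow, ?_, hm0⟩
  have hc0 : 0 < cA ν μ k a n := lt_of_lt_of_le hs0 hlow
  exact inf_level (F := fun c => (n.choose 2 : ℝ) * twoInt ν μ k n c) hne hc0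
    ((twoInt_cont hμ0 hc0).const_mul _)

/-- for `α > 2 - 2/k`, `a > 0` and `δ ∈ (0,1/2)`, the truncated clique
expectation with `k` small weights plus the hub term with `k-2` hubs of weight `c_a(n)`
is asymptotically `(1+a) m_n^{(k)}`: the first term is `m_n^{(k)}(1+o(1))` and the
second is `a m_n^{(k)}(1+o(1))`. -/
theorem stmt17
    (α : ℝ) (hα : α ∈ Set.Ioo (1 : ℝ) 2)
    (ν : Measure ℝ) [IsProbabilityMeasure ν]
    (hsupp : ν (Set.Iio 1) = 0)
    (htail : Tendsto (fun x : ℝ => x ^ α * (ν (Set.Ioi x)).toReal) atTop (nhds 1))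
    (g : ℝ → ℝ)
    (hdens : ν = MeasureTheory.volume.withDensity (fun x => ENNReal.ofReal (g x)))
    (hgtail : Tendsto (fun x : ℝ => g x * x ^ (α + 1)) atTop (nhds α))
    (hint : Integrable (fun x : ℝ => x) ν)
    (μ : ℝ) (hμ : μ = ∫ x, x ∂ν)
    (k : ℕ) (hk : 3 ≤ k)
    (hα2 : 2 - 2 / (k : ℝ) < α)
    (a : ℝ) (ha : 0 < a)
    (δ : ℝ) (hδ : δ ∈ Set.Ioo (0 : ℝ) (1 / 2)) :
    Tendsto (fun n : ℕ =>
        (((n - (k - 2)).choose k : ℝ) *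
            ∫ x in Set.univ.pi (fun _ : Fin k =>
                Set.Icc (1 : ℝ) ((n : ℝ) ^ ((1 : ℝ) / 2 + δ))),
              fDef μ n k x ∂(Measure.pi fun _ : Fin k => ν)) / mExp ν μ k n)
      atTop (nhds 1) ∧
    Tendsto (fun n : ℕ =>
        ((1 : ℝ) / 2 * ((n : ℝ) - ((k : ℝ) - 2)) ^ 2 *
            ∫ x in Set.Icc (1 : ℝ) ((n : ℝ) ^ ((1 : ℝ) / 2 + δ)),
              ∫ y in Set.Icc (1 : ℝ) ((n : ℝ) ^ ((1 : ℝ) / 2 + δ)),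
                fDef μ n k (hubVec k x y (cA ν μ k a n)) ∂ν ∂ν) /
          (a * mExp ν μ k n))
      atTop (nhds 1) := by
  have hμ1 : 1 ≤ μ := hμ ▸ mu_ge hsupp hint
  have hμ0 : 0 < μ := by linarith
  obtain ⟨C, ε, hC, hε, hkey⟩ :=
    key_facts α hα ν htail g hdens hgtail μ hμ0 k hk δ hδ.1
  have hst := s_tendsto hμ0
  have hTs := Ts_tendsto hμ0 hδ.1
  constructor
  · have hA := ratio_tendsto
      (A := fun n : ℕ => ∫ x in Set.univ.pi (fun _ : Fin k => Set.Ici (1 : ℝ)),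
        fDef μ n k x ∂(Measure.pi fun _ : Fin k => ν))
      (B := fun n : ℕ => ∫ x in Set.univ.pi (fun _ : Fin k =>
                Set.Icc (1 : ℝ) ((n : ℝ) ^ ((1 : ℝ) / 2 + δ))),
              fDef μ n k x ∂(Measure.pi fun _ : Fin k => ν))
      (e := fun n : ℕ => k * (2 * C) ^ k * ((n : ℝ) ^ ((1 : ℝ) / 2 + δ) / √(μ * n)) ^ (-ε))
      (by
        filter_upwards [hkey, hst.eventually_gt_atTop 0] with n h hs
        exact lt_of_lt_of_le (by positivity) h.1)
      (by
        filter_upwards [hkey] with n h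
        exact h.2.2.2.1)
      (by
        filter_upwards [hkey] with n h
        refine h.2.2.2.2.trans ?_
        have e : (k : ℝ) * (C * √(μ * n) ^ (-α)) ^ k
            * ((n : ℝ) ^ ((1 : ℝ) / 2 + δ) / √(μ * n)) ^ (-ε)
            = k * (2 * C) ^ k * ((n : ℝ) ^ ((1 : ℝ) / 2 + δ) / √(μ * n)) ^ (-ε)
              * (1 / 2 * √(μ * n) ^ (-α)) ^ k := by
          have : (C * √(μ * n) ^ (-α)) ^ k = (2 * C) ^ k * (1 / 2 * √(μ * n) ^ (-α)) ^ k := by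
            rw [← mul_pow]
            congr 1
            ring
          rw [this]
          ring
        rw [e]
        exact mul_le_mul_of_nonneg_left h.1 (by positivity))
      (by
        have := ((tendsto_rpow_neg_atTop hε).comp hTs).const_mul (k * (2 * C) ^ k)
        rw [mul_zero] at this
        exact this)
    have := (choose_ratio k (k - 2)).mul hA
    rw [one_mul] at this
    refine this.congr fun n => ?_
    rw [mExp, mul_div_mul_comm]
  · have hlev := level_facts α hα ν hsupp μ hμ1 k hk hα2 a ha C hC
      (hkey.mono fun n h => ⟨h.1, h.2.1, h.2.2.1⟩)
    obtain ⟨x0, hx0, hg⟩ := g_bound hgtail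
    obtain ⟨c', hc', hmid⟩ := mid_lower hα.1 hint htail
    have hα1 : 0 < α - 1 := by linarith [hα.1]
    have htm : ∀ A : ℝ, x0 ≤ A → ∫ x in Ioi A, x ∂ν ≤ (α + 1) / (α - 1) * A ^ (1 - α) := by
      intro A hA
      simpa using (tail_moment hα.1 hdens hx0 hg hα.1 hA).2
    set D := (α + 1) / (α - 1) with hD
    have hD0 : 0 < D := div_pos (by linarith [hα.1]) hα1
    set d' : ℝ := (1 / 2) ^ (k - 2) * c' with hd'
    have hd0 : 0 < d' := by positivity
    have hA := ratio_tendsto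
      (A := fun n : ℕ => twoInt ν μ k n (cA ν μ k a n))
      (B := fun n : ℕ => ∫ x in Set.Icc (1 : ℝ) ((n : ℝ) ^ ((1 : ℝ) / 2 + δ)),
              ∫ y in Set.Icc (1 : ℝ) ((n : ℝ) ^ ((1 : ℝ) / 2 + δ)),
                fDef μ n k (hubVec k x y (cA ν μ k a n)) ∂ν ∂ν)
      (e := fun n : ℕ => (2 * D * (1 / d' + D / d' ^ 2)) *
        ((n : ℝ) ^ ((1 : ℝ) / 2 + δ) / √(μ * n)) ^ (-(α - 1)))
    have hpos : ∀ᶠ n : ℕ in atTop, 0 < twoInt ν μ k n (cA ν μ k a n) := by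
      filter_upwards [hlev] with n ⟨_, h2, h3⟩
      have h4 : 0 < (n.choose 2 : ℝ) * twoInt ν μ k n (cA ν μ k a n) := by
        rw [h2]
        positivity
      exact pos_of_mul_pos_right h4 (Nat.cast_nonneg _)
    have hdiff : ∀ᶠ n : ℕ in atTop, 0 ≤ twoInt ν μ k n (cA ν μ k a n) -
          (∫ x in Set.Icc (1 : ℝ) ((n : ℝ) ^ ((1 : ℝ) / 2 + δ)),
              ∫ y in Set.Icc (1 : ℝ) ((n : ℝ) ^ ((1 : ℝ) / 2 + δ)),
                fDef μ n k (hubVec k x y (cA ν μ k a n)) ∂ν ∂ν) ∧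
        twoInt ν μ k n (cA ν μ k a n) -
          (∫ x in Set.Icc (1 : ℝ) ((n : ℝ) ^ ((1 : ℝ) / 2 + δ)),
              ∫ y in Set.Icc (1 : ℝ) ((n : ℝ) ^ ((1 : ℝ) / 2 + δ)),
                fDef μ n k (hubVec k x y (cA ν μ k a n)) ∂ν ∂ν) ≤
        (2 * D * (1 / d' + D / d' ^ 2)) *
          ((n : ℝ) ^ ((1 : ℝ) / 2 + δ) / √(μ * n)) ^ (-(α - 1))
          * twoInt ν μ k n (cA ν μ k a n) := by
      filter_upwards [hlev, hpos, hst.eventually hmid, hst.eventually_ge_atTop 2,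
        hst.eventually_ge_atTop x0, hTs.eventually_ge_atTop 1] with n ⟨h1, _, _⟩ hp hm h2 h0 hT
      have hsq : √(μ * n) ^ 2 = μ * n := Real.sq_sqrt (by positivity)
      set s := √(μ * n) with hs
      set T := (n : ℝ) ^ ((1 : ℝ) / 2 + δ) with hTdef
      have hs0 : 0 < s := by linarith
      have hsT : s ≤ T := by rwa [one_le_div hs0] at hT
      have hT0 : 0 < T := by linarith
      have hd : 0 < d' * s ^ (1 - α) := mul_pos hd0 (Real.rpow_pos_of_pos hs0 _)
      have H := hub_diff (T := T) hint hk hμ0 h2 (by linarith) hsq h1 hd (by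
        rw [hd', mul_assoc]
        exact mul_le_mul_of_nonneg_left hm (by positivity))
      refine ⟨H.1, H.2.trans (mul_le_mul_of_nonneg_right ?_ hp.le)⟩
      have hq : 0 < s ^ (1 - α) := Real.rpow_pos_of_pos hs0 _
      have e : (2 * D * (1 / d' + D / d' ^ 2)) * (T / s) ^ (-(α - 1))
          = 2 * (D * T ^ (1 - α)) *
            (1 / (d' * s ^ (1 - α)) + (D * s ^ (1 - α)) / (d' * s ^ (1 - α)) ^ 2) := by
        rw [show -(α - 1) = 1 - α by ring, Real.div_rpow hT0.le hs0.le]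
        field_simp
      rw [e]
      have t1 := htm T (h0.trans hsT)
      have t2 := htm s h0
      have p2 : 0 ≤ ∫ x in Ioi s, x ∂ν :=
        setIntegral_nonneg measurableSet_Ioi fun x hx => hs0.le.trans (le_of_lt hx)
      gcongr
    have hA' := hA hpos (hdiff.mono fun n h => h.1) (hdiff.mono fun n h => h.2) (by
      have := ((tendsto_rpow_neg_atTop hα1).comp hTs).const_mul (2 * D * (1 / d' + D / d' ^ 2))
      rw [mul_zero] at this
      exact this)
    have := (half_ratio ((k : ℝ) - 2)).mul hA'
    rw [one_mul] at this
    refine this.congr' ?_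
    filter_upwards [hlev] with n ⟨_, h2, _⟩
    rw [← h2, mul_div_mul_comm]
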